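/- A twin-free graph G is a mixed unit interval graph if and only if G is an interval graph containing no induced subgraph isomorphic to K_{2,3}^*, nor to any graph in the families R_i (i ≥ 0), S_i (i ≥ 1), S'_i (i ≥ 1), or T_{i,j} (i ≥ j ≥ 0). -/

import Mathlib

open Set

/-- A unit interval of the real line: one of the four types of intervals of length 1. -/
def IsUnitInterval (s : Set ℝ) : Prop :=
  ∃ x : ℝ, s = Set.Icc x (x + 1) ∨ s = Set.Ioo x (x + 1) ∨
    s = Set.Ioc x (x + 1) ∨ s = Set.Ico x (x + 1)

/-- `f` is an intersection representation of `G`: distinct vertices are adjacent iff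
their assigned sets intersect. -/
def IsIntervalRep {V : Type*} (G : SimpleGraph V) (f : V → Set ℝ) : Prop :=
  ∀ u v : V, u ≠ v → (G.Adj u v ↔ (f u ∩ f v).Nonempty)

/-- A mixed unit interval graph: intersection graph of unit intervals of any of the four types. -/
def MixedUnitIntervalGraph {V : Type*} (G : SimpleGraph V) : Prop :=
  ∃ f : V → Set ℝ, IsIntervalRep G f ∧ ∀ v, IsUnitInterval (f v)

/-- `G` contains an induced subgraph isomorphic to `H`. -/
def HasInducedSubgraph {V W : Type*} (G : SimpleGraph V) (H : SimpleGraph W) : Prop :=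
  ∃ f : W ↪ V, ∀ a b : W, H.Adj a b ↔ G.Adj (f a) (f b)

/-- `G` is an interval graph (intersection graph of closed real intervals). -/
def IsIntervalGraph {V : Type*} (G : SimpleGraph V) : Prop :=
  ∃ f : V → Set ℝ, IsIntervalRep G f ∧ ∀ v, ∃ a b : ℝ, f v = Set.Icc a b

/-- `G` is twin-free: distinct vertices have distinct closed neighborhoods. -/
def TwinFree {V : Type*} (G : SimpleGraph V) : Prop :=
  ∀ u v : V, insert u (G.neighborSet u) = insert v (G.neighborSet v) → u = v

/-! ### The forbidden families R_k, S_k, S'_k, S''_k, T_{i,j}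

`Qgraph k` is the graph Q_k (R_k minus two degree-1 vertices with a common neighbor):
a path p_1 ... p_{k+1} (indices 0..k), triangle vertices t_1 ... t_k (index i-1
for t_i, adjacent to p_i and p_{i+1}), and two pendant vertices attached at p_1.
Its special vertices are p_{k+1} and t_k. -/

abbrev QVert (k : ℕ) := Fin (k + 1) ⊕ (Fin k ⊕ Fin 2)

def Qadj (k : ℕ) : QVert k → QVert k → Prop
  | Sum.inl m, Sum.inl m' => (m' : ℕ) = (m : ℕ) + 1
  | Sum.inr (Sum.inl i), Sum.inl m => (m : ℕ) = (i : ℕ) ∨ (m : ℕ) = (i : ℕ) + 1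
  | Sum.inr (Sum.inr _), Sum.inl m => (m : ℕ) = 0
  | _, _ => False

def Qgraph (k : ℕ) : SimpleGraph (QVert k) := SimpleGraph.fromRel (Qadj k)

/-- The first special vertex of Q_k : the path endpoint p_{k+1}. -/
def Qspecial1 (k : ℕ) : QVert k := Sum.inl (Fin.last k)

/-- The second special vertex of Q_k : the triangle vertex t_k
(for k = 0 a pendant vertex). -/
def Qspecial2 (k : ℕ) : QVert k :=
  if h : k = 0 then Sum.inr (Sum.inr 1) else Sum.inr (Sum.inl ⟨k - 1, by omega⟩)

/-- R_k : a path p_0 ... p_{k+2}, triangle vertices t_1 ... t_k (index i-1 for t_i,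
adjacent to p_i and p_{i+1}) and two further leaves adjacent to p_1 and p_{k+1}. -/
def Radj (k : ℕ) : (Fin (k + 3) ⊕ (Fin k ⊕ Fin 2)) → (Fin (k + 3) ⊕ (Fin k ⊕ Fin 2)) → Prop
  | Sum.inl m, Sum.inl m' => (m' : ℕ) = (m : ℕ) + 1
  | Sum.inr (Sum.inl i), Sum.inl m => (m : ℕ) = (i : ℕ) + 1 ∨ (m : ℕ) = (i : ℕ) + 2
  | Sum.inr (Sum.inr j), Sum.inl m =>
      ((j : ℕ) = 0 ∧ (m : ℕ) = 1) ∨ ((j : ℕ) = 1 ∧ (m : ℕ) = k + 1)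
  | _, _ => False

def Rgraph (k : ℕ) : SimpleGraph (Fin (k + 3) ⊕ (Fin k ⊕ Fin 2)) :=
  SimpleGraph.fromRel (Radj k)

/-- The third neighbor of the extra vertex z in S_k : the triangle vertex t_{k-1}
if k ≥ 2, and a pendant vertex of Q_1 if k = 1. -/
def Sextra (k : ℕ) : QVert k :=
  if h : k ≤ 1 then Sum.inr (Sum.inr 0) else Sum.inr (Sum.inl ⟨k - 2, by omega⟩)

/-- S_k (k ≥ 1): Q_k together with an extra vertex z adjacent to t_k, p_k and
(t_{k-1} if k ≥ 2, a pendant of Q_1 if k = 1). -/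
def Sadj (k : ℕ) : (QVert k ⊕ Unit) → (QVert k ⊕ Unit) → Prop
  | Sum.inl a, Sum.inl b => Qadj k a b
  | Sum.inr _, Sum.inl b =>
      b = Qspecial2 k ∨ b = Sum.inl ⟨k - 1, by omega⟩ ∨ b = Sextra k
  | _, _ => False

def Sgraph (k : ℕ) : SimpleGraph (QVert k ⊕ Unit) := SimpleGraph.fromRel (Sadj k)

/-- S'_k (k ≥ 1): Q_k together with an extra vertex z adjacent to the two special
vertices p_{k+1} and t_k of Q_k and to their common neighbor p_k. -/
def S'adj (k : ℕ) : (QVert k ⊕ Unit) → (QVert k ⊕ Unit) → Prop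
  | Sum.inl a, Sum.inl b => Qadj k a b
  | Sum.inr _, Sum.inl b =>
      b = Qspecial1 k ∨ b = Qspecial2 k ∨ b = Sum.inl ⟨k - 1, by omega⟩
  | _, _ => False

def S'graph (k : ℕ) : SimpleGraph (QVert k ⊕ Unit) := SimpleGraph.fromRel (S'adj k)

/-- S''_k (k ≥ 2): S_k together with the extra edge between z and p_{k-1}. -/
def S''adj (k : ℕ) : (QVert k ⊕ Unit) → (QVert k ⊕ Unit) → Prop
  | Sum.inl a, Sum.inl b => Qadj k a b
  | Sum.inr _, Sum.inl b =>
      b = Qspecial2 k ∨ b = Sum.inl ⟨k - 1, by omega⟩ ∨ b = Sextra k ∨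
        b = Sum.inl ⟨k - 2, by omega⟩
  | _, _ => False

def S''graph (k : ℕ) : SimpleGraph (QVert k ⊕ Unit) := SimpleGraph.fromRel (S''adj k)

/-- T_{i,j}: the disjoint union of Q_i and Q_j together with the three edges
v_i v_j, v_i w_j and w_i v_j between the special vertices (v = Qspecial1, w = Qspecial2). -/
def Tadj (i j : ℕ) : (QVert i ⊕ QVert j) → (QVert i ⊕ QVert j) → Prop
  | Sum.inl a, Sum.inl b => Qadj i a b
  | Sum.inr a, Sum.inr b => Qadj j a b
  | Sum.inl a, Sum.inr b =>
      (a = Qspecial1 i ∧ b = Qspecial1 j) ∨ (a = Qspecial1 i ∧ b = Qspecial2 j) ∨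
        (a = Qspecial2 i ∧ b = Qspecial1 j)
  | _, _ => False

def Tgraph (i j : ℕ) : SimpleGraph (QVert i ⊕ QVert j) := SimpleGraph.fromRel (Tadj i j)

/-- K_{2,3}^*: K_{2,3} with parts {0,1} and {2,3,4}, with the extra edge 01. -/
def K23star : SimpleGraph (Fin 5) := SimpleGraph.fromRel (fun u v =>
  (u = 0 ∧ v = 1) ∨ ((u = 0 ∨ u = 1) ∧ (v = 2 ∨ v = 3 ∨ v = 4)))


/-! ## Interval orders and ordered configurations -/

namespace MixedUnit

/-- `P` is an interval order whose incomparability graph is `G`. -/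
structure Good {V : Type*} (G : SimpleGraph V) (P : V → V → Prop) : Prop where
  irr : ∀ a, ¬ P a a
  io : ∀ a b c d, P a b → P c d → P a d ∨ P c b
  adj : ∀ u v, G.Adj u v ↔ u ≠ v ∧ ¬ P u v ∧ ¬ P v u

theorem Good.trans {V : Type*} {G : SimpleGraph V} {P : V → V → Prop} (h : Good G P)
    {a b c : V} (h1 : P a b) (h2 : P b c) : P a c := by
  rcases h.io a b b c h1 h2 with h3 | h3
  · exact h3
  · exact absurd h3 (h.irr b)

theorem Good.asymm {V : Type*} {G : SimpleGraph V} {P : V → V → Prop} (h : Good G P)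
    {a b : V} (h1 : P a b) : ¬ P b a := fun h2 => h.irr a (h.trans h1 h2)

theorem Good.swap {V : Type*} {G : SimpleGraph V} {P : V → V → Prop} (h : Good G P) :
    Good G (fun a b => P b a) where
  irr := h.irr
  io := fun a b c d h1 h2 => (h.io b a d c h1 h2 |>.symm.imp id id |> fun
    | Or.inl h => Or.inl h
    | Or.inr h => Or.inr h)
  adj := fun u v => by rw [h.adj]; tauto

/-- Ordered relation between two vertices: comparable (and not related by `r`), or
overlapping, different, and related by `r`. -/
def Match {V W : Type*} (P : V → V → Prop) (r : W → W → Prop) (f : W → V) (a b : W) : Prop :=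
  ((P (f a) (f b) ∨ P (f b) (f a)) ∧ ¬ r a b ∧ ¬ r b a) ∨
  (¬ P (f a) (f b) ∧ ¬ P (f b) (f a) ∧ f a ≠ f b ∧ (r a b ∨ r b a))

theorem Match.symm {V W : Type*} {P : V → V → Prop} {r : W → W → Prop} {f : W → V} {a b : W}
    (h : Match P r f a b) : Match P r f b a := by
  unfold Match at *; tauto

theorem induced_of_match {V W : Type*} {G : SimpleGraph V} {P : V → V → Prop} (hG : Good G P)
    {r : W → W → Prop} (f : W → V) (h : ∀ a b, a ≠ b → Match P r f a b) :
    HasInducedSubgraph G (SimpleGraph.fromRel r) := by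
  have hinj : Function.Injective f := by
    intro a b hab
    by_contra hne
    rcases h a b hne with h1 | h1
    · rw [hab] at h1
      exact hG.irr _ (h1.1.elim id id)
    · exact h1.2.2.1 hab
  refine ⟨⟨f, hinj⟩, fun a b => ?_⟩
  rw [SimpleGraph.fromRel_adj, hG.adj]
  simp only [Function.Embedding.coeFn_mk]
  constructor
  · rintro ⟨hne, hr⟩
    have := h a b hne
    unfold Match at this
    tauto
  · rintro ⟨hne, h1, h2⟩
    have hab : a ≠ b := fun e => hne (by rw [e])
    have := h a b hab
    unfold Match at this
    tauto

/-- The chain of vertices of an induced `Q_k`, in left-to-right order. -/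
structure QSeq {V : Type*} (P : V → V → Prop) (k : ℕ) (vs ws : ℕ → V) (l : V) : Prop where
  lw : ∀ j ≤ k, P l (ws j)
  lv : ∀ j ≤ k, 0 < j → P l (vs j)
  l0 : ¬ P l (vs 0) ∧ ¬ P (vs 0) l ∧ l ≠ vs 0
  wv : ∀ i j, i < j → j ≤ k → P (ws i) (vs j)
  ww : ∀ i j, i < j → j ≤ k → P (ws i) (ws j)
  vw : ∀ i ≤ k, ¬ P (vs i) (ws i) ∧ ¬ P (ws i) (vs i) ∧ vs i ≠ ws i
  v1 : ∀ i, i + 1 ≤ k → ¬ P (vs i) (vs (i + 1)) ∧ ¬ P (vs (i + 1)) (vs i) ∧ vs i ≠ vs (i + 1)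
  w1 : ∀ i, i + 1 ≤ k → ¬ P (vs i) (ws (i + 1)) ∧ ¬ P (ws (i + 1)) (vs i) ∧ vs i ≠ ws (i + 1)
  v2 : ∀ i j, i + 2 ≤ j → j ≤ k → P (vs i) (vs j)
  w2 : ∀ i j, i + 2 ≤ j → j ≤ k → P (vs i) (ws j)

theorem K_induced {V : Type*} {G : SimpleGraph V} {P : V → V → Prop} (hG : Good G P)
    {c d l m r : V} (hcl : ¬ P c l) (hlc : ¬ P l c) (hcr : ¬ P c r) (hrc : ¬ P r c)
    (hdl : ¬ P d l) (hld : ¬ P l d) (hdr : ¬ P d r) (hrd : ¬ P r d)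
    (hlm : P l m) (hmr : P m r) (hcd : c ≠ d) : HasInducedSubgraph G K23star := by
  have hcm : ¬ P c m := fun h => hcr (hG.trans h hmr)
  have hmc : ¬ P m c := fun h => hlc (hG.trans hlm h)
  have hdm : ¬ P d m := fun h => hdr (hG.trans h hmr)
  have hmd : ¬ P m d := fun h => hld (hG.trans hlm h)
  have hlr : P l r := hG.trans hlm hmr
  have h1 : ¬ P c d := fun h => by
    rcases hG.io _ _ _ _ h hlr with h | h
    · exact hcr h
    · exact hld h
  have h2 : ¬ P d c := fun h => by
    rcases hG.io _ _ _ _ h hlr with h | h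
    · exact hdr h
    · exact hlc h
  have nlm : c ≠ l := fun h => hcm (h ▸ hlm)
  have nm : c ≠ m := fun h => hcr (h ▸ hmr)
  have nr : c ≠ r := fun h => hlc (h ▸ hlr)
  have nl' : d ≠ l := fun h => hdm (h ▸ hlm)
  have nm' : d ≠ m := fun h => hdr (h ▸ hmr)
  have nr' : d ≠ r := fun h => hld (h ▸ hlr)
  have hs : ∀ a b : Fin 5, a < b → Match P (fun u v : Fin 5 =>
      (u = 0 ∧ v = 1) ∨ ((u = 0 ∨ u = 1) ∧ (v = 2 ∨ v = 3 ∨ v = 4))) ![c, d, l, m, r] a b := by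
    intro a b hab
    unfold Match
    fin_cases a <;> fin_cases b <;> simp at hab <;> simp_all
  refine induced_of_match hG ![c, d, l, m, r] ?_
  intro a b hab
  rcases lt_or_gt_of_ne hab with h | h
  · exact hs a b h
  · exact (hs b a h).symm

/-- vertices of `R_k` -/
def fR {V : Type*} (k : ℕ) (vs ws : ℕ → V) (l y1 y2 : V) : Fin (k + 3) ⊕ (Fin k ⊕ Fin 2) → V
  | Sum.inl m => if (m : ℕ) = 0 then l else if (m : ℕ) = k + 2 then y1 else vs (m - 1)
  | Sum.inr (Sum.inl i) => ws (i + 1)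
  | Sum.inr (Sum.inr j) => if (j : ℕ) = 0 then ws 0 else y2

theorem R_induced {V : Type*} {G : SimpleGraph V} {P : V → V → Prop} (hG : Good G P)
    {k : ℕ} {vs ws : ℕ → V} {l : V} (hQ : QSeq P k vs ws l) {y1 y2 : V}
    (h1 : P (ws k) y1) (h2 : P (ws k) y2) (h3 : ¬ P (vs k) y1) (h4 : ¬ P (vs k) y2)
    (h5 : ∀ i < k, P (vs i) y1) (h6 : ∀ i < k, P (vs i) y2) (h7 : P y1 y2) :
    HasInducedSubgraph G (Rgraph k) := by
  have hw1 : ∀ i ≤ k, P (ws i) y1 := fun i hi => by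
    rcases Nat.lt_or_ge i k with h | h
    · exact hG.trans (hQ.ww i k h le_rfl) h1
    · rwa [le_antisymm hi h]
  have hw2 : ∀ i ≤ k, P (ws i) y2 := fun i hi => by
    rcases Nat.lt_or_ge i k with h | h
    · exact hG.trans (hQ.ww i k h le_rfl) h2
    · rwa [le_antisymm hi h]
  have hl1 : P l y1 := hG.trans (hQ.lw k le_rfl) h1
  have hl2 : P l y2 := hG.trans (hQ.lw k le_rfl) h2
  have h3' : ¬ P y1 (vs k) := fun h => (hQ.vw k le_rfl).2.1 (hG.trans h1 h)
  have h4' : ¬ P y2 (vs k) := fun h => (hQ.vw k le_rfl).2.1 (hG.trans h2 h)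
  have n3 : vs k ≠ y1 := fun h => (hQ.vw k le_rfl).2.1 (h ▸ h1)
  have n4 : vs k ≠ y2 := fun h => (hQ.vw k le_rfl).2.1 (h ▸ h2)
  have hll : ∀ m m' : Fin (k + 3), m < m' →
      Match P (Radj k) (fR k vs ws l y1 y2) (Sum.inl m) (Sum.inl m') := by
    intro m m' hm
    obtain ⟨m, hmk⟩ := m
    obtain ⟨m', hmk'⟩ := m'
    simp only [Fin.mk_lt_mk] at hm
    rcases m with _ | n
    · rcases Nat.lt_or_ge m' (k + 2) with h | h
      · obtain ⟨n', rfl⟩ : ∃ n', m' = n' + 1 := ⟨m' - 1, by omega⟩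
        have e : ¬ (n' + 1 = k + 2) := by omega
        rcases Nat.eq_zero_or_pos n' with rfl | hn'
        · right
          have := hQ.l0
          simp [fR, Radj]
          tauto
        · left
          have := hQ.lv n' (by omega) hn'
          simp [fR, Radj, show ¬ (n' = k + 1) by omega, this]
          omega
      · obtain rfl : m' = k + 2 := by omega
        left
        simp [fR, Radj, hl1]
    · rcases Nat.lt_or_ge m' (k + 2) with h | h
      · obtain ⟨n', rfl⟩ : ∃ n', m' = n' + 1 := ⟨m' - 1, by omega⟩
        rcases Nat.lt_or_ge (n + 1) n' with h' | h'
        · left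
          have := hQ.v2 n n' (by omega) (by omega)
          simp [fR, Radj, show ¬ (n' = k + 1) by omega, show ¬ (n = k + 1) by omega, this]
          omega
        · obtain rfl : n' = n + 1 := by omega
          right
          have := hQ.v1 n (by omega)
          simp [fR, Radj, show ¬ (n = k) by omega, show ¬ (n = k + 1) by omega, this]
      · obtain rfl : m' = k + 2 := by omega
        rcases Nat.lt_or_ge n k with h' | h'
        · left
          have := h5 n h'
          simp [fR, Radj, show ¬ (n = k + 1) by omega, this]
          omega
        · obtain rfl : n = k := by omega
          right
          simp [fR, Radj, h3, h3', n3]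
  have htl : ∀ (i : Fin k) (m : Fin (k + 3)),
      Match P (Radj k) (fR k vs ws l y1 y2) (Sum.inr (Sum.inl i)) (Sum.inl m) := by
    intro i m
    obtain ⟨i, hi⟩ := i
    obtain ⟨m, hm⟩ := m
    rcases m with _ | n
    · left
      have := hQ.lw (i + 1) (by omega)
      simp [fR, Radj, this]
    · rcases Nat.lt_or_ge n (k + 1) with h | h
      · have e : ¬ (n = k + 1) := by omega
        rcases lt_trichotomy n (i + 1) with h' | rfl | h'
        · rcases Nat.lt_or_ge n i with h'' | h''
          · left
            have := hQ.w2 n (i + 1) (by omega) (by omega)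
            simp [fR, Radj, this, e]
            omega
          · obtain rfl : n = i := by omega
            right
            have := hQ.w1 n (by omega)
            simp [fR, Radj, this, e, this.2.2.symm]
        · right
          have := hQ.vw (i + 1) (by omega)
          simp [fR, Radj, this, show ¬ (i = k) by omega, this.2.2.symm]
        · left
          have := hQ.wv (i + 1) n (by omega) (by omega)
          simp [fR, Radj, this, e]
          omega
      · obtain rfl : n = k + 1 := by omega
        left
        have := hw1 (i + 1) (by omega)
        simp [fR, Radj, this]
        omega
  have hsl : ∀ (i : Fin 2) (m : Fin (k + 3)),
      Match P (Radj k) (fR k vs ws l y1 y2) (Sum.inr (Sum.inr i)) (Sum.inl m) := by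
    intro i m
    obtain ⟨m, hm⟩ := m
    have hlw0 := hQ.lw 0 (by omega)
    have hw10 := hw1 0 (by omega)
    rcases m with _ | n
    · left
      fin_cases i <;> simp [fR, Radj, hlw0, hl2]
    · rcases Nat.lt_or_ge n (k + 1) with h | h
      · have e : ¬ (n = k + 1) := by omega
        fin_cases i
        · rcases Nat.eq_zero_or_pos n with rfl | h'
          · right
            have := hQ.vw 0 (by omega)
            simp [fR, Radj, this, this.2.2.symm]
          · left
            have := hQ.wv 0 n (by omega) (by omega)
            simp [fR, Radj, e, this]
            omega
        · rcases Nat.lt_or_ge n k with h' | h'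
          · left
            have := h6 n h'
            simp [fR, Radj, e, this]
            omega
          · obtain rfl : n = k := by omega
            right
            simp [fR, Radj, h4, h4', n4.symm]
      · obtain rfl : n = k + 1 := by omega
        left
        fin_cases i
        · simp [fR, Radj, hw10]
        · simp [fR, Radj, h7]
  have htt : ∀ (i j : Fin k), i < j → Match P (Radj k) (fR k vs ws l y1 y2)
      (Sum.inr (Sum.inl i)) (Sum.inr (Sum.inl j)) := by
    intro i j hij
    left
    have := hQ.ww (i + 1) (j + 1) (by omega) (by omega)
    simp [fR, Radj, this]
  have hts : ∀ (i : Fin k) (j : Fin 2), Match P (Radj k) (fR k vs ws l y1 y2)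
      (Sum.inr (Sum.inl i)) (Sum.inr (Sum.inr j)) := by
    intro i j
    left
    have h8 := hQ.ww 0 (i + 1) (by omega) (by omega)
    have h9 := hw2 (i + 1) (by omega)
    fin_cases j <;> simp [fR, Radj, h8, h9]
  have hss : ∀ (i j : Fin 2), i ≠ j → Match P (Radj k) (fR k vs ws l y1 y2)
      (Sum.inr (Sum.inr i)) (Sum.inr (Sum.inr j)) := by
    intro i j hij
    left
    have h9 := hw2 0 (by omega)
    fin_cases i <;> fin_cases j <;> simp_all [fR, Radj]
  refine induced_of_match hG (fR k vs ws l y1 y2) ?_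
  rintro (m | i | s) (m' | i' | s') hne
  · rcases lt_trichotomy m m' with h | h | h
    · exact hll _ _ h
    · exact absurd (by rw [h]) hne
    · exact (hll _ _ h).symm
  · exact (htl _ _).symm
  · exact (hsl _ _).symm
  · exact htl _ _
  · rcases lt_trichotomy i i' with h | h | h
    · exact htt _ _ h
    · exact absurd (by rw [h]) hne
    · exact (htt _ _ h).symm
  · exact hts _ _
  · exact hsl _ _
  · exact (hts _ _).symm
  · exact hss _ _ (by simpa using hne)

end MixedUnit


namespace MixedUnit

/-- vertices of `Q_k` -/
def fQ {V : Type*} (k : ℕ) (vs ws : ℕ → V) (a b : V) : QVert k → V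
  | Sum.inl m => vs m
  | Sum.inr (Sum.inl i) => ws (i + 1)
  | Sum.inr (Sum.inr j) => if (j : ℕ) = 0 then a else b

theorem Q_match {V : Type*} {G : SimpleGraph V} {P : V → V → Prop} (_hG : Good G P)
    {k : ℕ} {vs ws : ℕ → V} {l : V} (hQ : QSeq P k vs ws l) {a b : V}
    (hab : (a = l ∧ b = ws 0) ∨ (a = ws 0 ∧ b = l)) (s t : QVert k) (hst : s ≠ t) :
    Match P (Qadj k) (fQ k vs ws a b) s t := by
  have hll : ∀ m m' : Fin (k + 1), m < m' →
      Match P (Qadj k) (fQ k vs ws a b) (Sum.inl m) (Sum.inl m') := by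
    intro m m' hm
    obtain ⟨n, hmk⟩ := m
    obtain ⟨n', hmk'⟩ := m'
    simp only [Fin.mk_lt_mk] at hm
    rcases Nat.lt_or_ge (n + 1) n' with h' | h'
    · left
      have := hQ.v2 n n' (by omega) (by omega)
      simp [fQ, Qadj, this]
      omega
    · obtain rfl : n' = n + 1 := by omega
      right
      have := hQ.v1 n (by omega)
      simp [fQ, Qadj, this]
  have htl : ∀ (i : Fin k) (m : Fin (k + 1)),
      Match P (Qadj k) (fQ k vs ws a b) (Sum.inr (Sum.inl i)) (Sum.inl m) := by
    intro i m
    obtain ⟨i, hi⟩ := i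
    obtain ⟨n, hm⟩ := m
    rcases lt_trichotomy n (i + 1) with h' | rfl | h'
    · rcases Nat.lt_or_ge n i with h'' | h''
      · left
        have := hQ.w2 n (i + 1) (by omega) (by omega)
        simp [fQ, Qadj, this]
        omega
      · obtain rfl : n = i := by omega
        right
        have := hQ.w1 n (by omega)
        simp [fQ, Qadj, this, this.2.2.symm]
    · right
      have := hQ.vw (i + 1) (by omega)
      simp [fQ, Qadj, this, this.2.2.symm]
    · left
      have := hQ.wv (i + 1) n (by omega) (by omega)
      simp [fQ, Qadj, this]
      omega
  have hsl : ∀ (i : Fin 2) (m : Fin (k + 1)),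
      Match P (Qadj k) (fQ k vs ws a b) (Sum.inr (Sum.inr i)) (Sum.inl m) := by
    intro i m
    obtain ⟨n, hm⟩ := m
    rcases Nat.eq_zero_or_pos n with rfl | h'
    · right
      have h1 := hQ.vw 0 (by omega)
      have h2 := hQ.l0
      have h3 := h1.2.2.symm
      rcases hab with ⟨rfl, rfl⟩ | ⟨rfl, rfl⟩ <;> fin_cases i <;>
        simp [fQ, Qadj, h1, h2, h3]
    · left
      have h1 := hQ.wv 0 n (by omega) (by omega)
      have h2 := hQ.lv n (by omega) (by omega)
      rcases hab with ⟨rfl, rfl⟩ | ⟨rfl, rfl⟩ <;> fin_cases i <;>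
        simp [fQ, Qadj, h1, h2] <;> omega
  have htt : ∀ (i j : Fin k), i < j → Match P (Qadj k) (fQ k vs ws a b)
      (Sum.inr (Sum.inl i)) (Sum.inr (Sum.inl j)) := by
    intro i j hij
    left
    have := hQ.ww (i + 1) (j + 1) (by omega) (by omega)
    simp [fQ, Qadj, this]
  have hts : ∀ (i : Fin k) (j : Fin 2), Match P (Qadj k) (fQ k vs ws a b)
      (Sum.inr (Sum.inl i)) (Sum.inr (Sum.inr j)) := by
    intro i j
    left
    have h8 := hQ.ww 0 (i + 1) (by omega) (by omega)
    have h9 := hQ.lw (i + 1) (by omega)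
    rcases hab with ⟨rfl, rfl⟩ | ⟨rfl, rfl⟩ <;> fin_cases j <;> simp [fQ, Qadj, h8, h9]
  have hss : ∀ (i j : Fin 2), i ≠ j → Match P (Qadj k) (fQ k vs ws a b)
      (Sum.inr (Sum.inr i)) (Sum.inr (Sum.inr j)) := by
    intro i j hij
    left
    have h9 := hQ.lw 0 (by omega)
    rcases hab with ⟨rfl, rfl⟩ | ⟨rfl, rfl⟩ <;> fin_cases i <;> fin_cases j <;>
      simp_all [fQ, Qadj]
  rcases s with m | i | s <;> rcases t with m' | i' | s'
  · rcases lt_trichotomy m m' with h | h | h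
    · exact hll _ _ h
    · exact absurd (by rw [h]) hst
    · exact (hll _ _ h).symm
  · exact (htl _ _).symm
  · exact (hsl _ _).symm
  · exact htl _ _
  · rcases lt_trichotomy i i' with h | h | h
    · exact htt _ _ h
    · exact absurd (by rw [h]) hst
    · exact (htt _ _ h).symm
  · exact hts _ _
  · exact hsl _ _
  · exact (hts _ _).symm
  · exact hss _ _ (by simpa using hst)

/-- The vertices of an ordered `Q_k` other than the two special ones. -/
def NS {V : Type*} (k : ℕ) (vs ws : ℕ → V) (l n : V) : Prop :=
  n = l ∨ ∃ i < k, n = vs i ∨ n = ws i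

/-- Classification of the vertices of `Q_k`. -/
theorem Q_cases {V : Type*} (k : ℕ) (vs ws : ℕ → V) (l : V) (a : QVert k) :
    (a = Qspecial1 k ∧ fQ k vs ws l (ws 0) a = vs k) ∨
    (a ≠ Qspecial1 k ∧ a = Qspecial2 k ∧ fQ k vs ws l (ws 0) a = ws k) ∨
    (a ≠ Qspecial1 k ∧ a ≠ Qspecial2 k ∧ NS k vs ws l (fQ k vs ws l (ws 0) a)) := by
  rcases a with ⟨m, hm⟩ | ⟨i, hi⟩ | s
  · by_cases h : m = k
    · left
      subst h
      exact ⟨rfl, rfl⟩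
    · right; right
      refine ⟨?_, ?_, ?_⟩
      · simp [Qspecial1, Fin.ext_iff]; exact h
      · unfold Qspecial2; split <;> simp
      · exact Or.inr ⟨m, by omega, Or.inl rfl⟩
  · right
    by_cases h : i + 1 = k
    · left
      refine ⟨by simp [Qspecial1], ?_, by simp [fQ, h]⟩
      unfold Qspecial2
      rw [dif_neg (by omega)]
      simp
      omega
    · right
      refine ⟨by simp [Qspecial1], ?_, Or.inr ⟨i + 1, by omega, Or.inr rfl⟩⟩
      unfold Qspecial2
      rw [dif_neg (by omega)]
      simp
      omega
  · right
    by_cases h : k = 0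
    · subst h
      fin_cases s
      · right
        exact ⟨by simp [Qspecial1], by simp [Qspecial2], Or.inl rfl⟩
      · left
        exact ⟨by simp [Qspecial1], by simp [Qspecial2], rfl⟩
    · right
      refine ⟨by simp [Qspecial1], by simp [Qspecial2, h], ?_⟩
      fin_cases s
      · exact Or.inl rfl
      · exact Or.inr ⟨0, by omega, Or.inr rfl⟩

theorem T_induced {V : Type*} {G : SimpleGraph V} {P : V → V → Prop} (hG : Good G P)
    {k j : ℕ} {vs ws vs' ws' : ℕ → V} {l l' : V} (hQ : QSeq P k vs ws l)
    (hQ' : QSeq (fun a b => P b a) j vs' ws' l')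
    (h1 : ¬ P (vs k) (vs' j) ∧ ¬ P (vs' j) (vs k) ∧ vs k ≠ vs' j)
    (h2 : ¬ P (vs k) (ws' j) ∧ ¬ P (ws' j) (vs k) ∧ vs k ≠ ws' j)
    (h3 : ¬ P (ws k) (vs' j) ∧ ¬ P (vs' j) (ws k) ∧ ws k ≠ vs' j)
    (h4 : P (ws k) (ws' j))
    (h5 : ∀ n, NS k vs ws l n → P n (vs' j) ∧ P n (ws' j))
    (h6 : ∀ n, NS j vs' ws' l' n → P (vs k) n ∧ P (ws k) n)
    (h7 : ∀ n n', NS k vs ws l n → NS j vs' ws' l' n' → P n n') :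
    HasInducedSubgraph G (Tgraph k j) := by
  have hcross : ∀ a b, Match P (Tadj k j)
      (Sum.elim (fQ k vs ws l (ws 0)) (fQ j vs' ws' l' (ws' 0))) (Sum.inl a) (Sum.inr b) := by
    intro a b
    unfold Match
    simp only [Sum.elim_inl, Sum.elim_inr, Tadj]
    rcases Q_cases k vs ws l a with ⟨ha, ha'⟩ | ⟨ha, ha1, ha'⟩ | ⟨ha, ha1, ha'⟩ <;>
    rcases Q_cases j vs' ws' l' b with ⟨hb, hb'⟩ | ⟨hb, hb1, hb'⟩ | ⟨hb, hb1, hb'⟩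
    · right; rw [ha', hb']; tauto
    · right; rw [ha', hb']; tauto
    · left; rw [ha']
      have := h6 _ hb'
      tauto
    · right; rw [ha', hb']; tauto
    · left; rw [ha', hb']; tauto
    · left; rw [ha']
      have := h6 _ hb'
      tauto
    · left; rw [hb']
      have := h5 _ ha'
      tauto
    · left; rw [hb']
      have := h5 _ ha'
      tauto
    · left
      have := h7 _ _ ha' hb'
      tauto
  refine induced_of_match hG (Sum.elim (fQ k vs ws l (ws 0)) (fQ j vs' ws' l' (ws' 0))) ?_
  rintro (a | a) (b | b) hne
  · exact Q_match hG hQ (Or.inl ⟨rfl, rfl⟩) a b (fun h => hne (by rw [h]))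
  · exact hcross a b
  · exact (hcross b a).symm
  · have := Q_match hG.swap hQ' (Or.inl ⟨rfl, rfl⟩) a b (fun h => hne (by rw [h]))
    unfold Match at *
    simp only [Sum.elim_inr, Tadj]
    tauto

theorem S'_induced {V : Type*} {G : SimpleGraph V} {P : V → V → Prop} (hG : Good G P)
    {k : ℕ} {vs ws : ℕ → V} {l : V} (hQ : QSeq P (k + 1) vs ws l) {z : V}
    (h1 : ¬ P z (vs (k + 1)) ∧ ¬ P (vs (k + 1)) z ∧ z ≠ vs (k + 1))
    (h2 : ¬ P z (ws (k + 1)) ∧ ¬ P (ws (k + 1)) z ∧ z ≠ ws (k + 1))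
    (h3 : ¬ P z (vs k) ∧ ¬ P (vs k) z ∧ z ≠ vs k)
    (h4 : P (ws k) z)
    (h5 : ∀ n, NS k vs ws l n → P n z) :
    HasInducedSubgraph G (S'graph (k + 1)) := by
  have hc : ∀ b u, Match P (S'adj (k + 1))
      (Sum.elim (fQ (k + 1) vs ws l (ws 0)) (fun _ : Unit => z)) (Sum.inr u) (Sum.inl b) := by
    intro b u
    unfold Match
    simp only [Sum.elim_inl, Sum.elim_inr, S'adj]
    rcases Q_cases (k + 1) vs ws l b with ⟨hb, hb'⟩ | ⟨hb, hb1, hb'⟩ | ⟨hb, hb1, hb'⟩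
    · right; rw [hb']; tauto
    · right; rw [hb']; tauto
    · by_cases hb2 : b = Sum.inl ⟨k, by omega⟩
      · right
        subst hb2
        have : fQ (k + 1) vs ws l (ws 0) (Sum.inl ⟨k, by omega⟩) = vs k := rfl
        rw [this]
        exact ⟨h3.1, h3.2.1, h3.2.2, Or.inl (Or.inr (Or.inr rfl))⟩
      · left
        have h0 : P (fQ (k + 1) vs ws l (ws 0) b) z := by
          rcases b with ⟨m, hm⟩ | ⟨i, hi⟩ | s
          · simp only [fQ]
            have : m ≠ k + 1 := by
              rintro rfl
              exact hb rfl
            have : m ≠ k := by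
              rintro rfl
              exact hb2 rfl
            exact h5 _ (Or.inr ⟨m, by omega, Or.inl rfl⟩)
          · simp only [fQ]
            by_cases hi2 : i + 1 < k
            · exact h5 _ (Or.inr ⟨i + 1, by omega, Or.inr rfl⟩)
            · have hik : i ≠ k := by
                rintro rfl
                exact hb1 (by simp [Qspecial2])
              obtain rfl : k = i + 1 := by omega
              exact h4
          · have hw : P (ws 0) z := by
              rcases Nat.eq_zero_or_pos k with rfl | hk
              · exact h4
              · exact h5 _ (Or.inr ⟨0, hk, Or.inr rfl⟩)
            fin_cases s
            · exact h5 _ (Or.inl rfl)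
            · exact hw
        refine ⟨Or.inr h0, ?_, by simp⟩
        simp only [Nat.add_sub_cancel]
        tauto
  refine induced_of_match hG (Sum.elim (fQ (k + 1) vs ws l (ws 0)) (fun _ : Unit => z)) ?_
  rintro (a | a) (b | b) hne
  · exact Q_match hG hQ (Or.inl ⟨rfl, rfl⟩) a b (fun h => hne (by rw [h]))
  · exact (hc _ _).symm
  · exact hc _ _
  · exact absurd rfl hne

theorem S_induced {V : Type*} {G : SimpleGraph V} {P : V → V → Prop} (hG : Good G P)
    {k : ℕ} {vs ws : ℕ → V} {l : V} (hQ : QSeq P (k + 1) vs ws l) {z : V}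
    (h1 : P z (vs (k + 1)))
    (h2 : ¬ P z (ws (k + 1)) ∧ ¬ P (ws (k + 1)) z ∧ z ≠ ws (k + 1))
    (h3 : ¬ P z (vs k) ∧ ¬ P (vs k) z ∧ z ≠ vs k)
    (h4 : ¬ P z (ws k) ∧ ¬ P (ws k) z ∧ z ≠ ws k)
    (h5 : ∀ n, NS k vs ws l n → P n z) :
    HasInducedSubgraph G (Sgraph (k + 1)) := by
  have hc : ∀ b u, Match P (Sadj (k + 1))
      (Sum.elim (fQ (k + 1) vs ws (ws 0) l) (fun _ : Unit => z)) (Sum.inr u) (Sum.inl b) := by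
    intro b u
    unfold Match
    simp only [Sum.elim_inl, Sum.elim_inr, Sadj, or_false, not_false_eq_true, and_true,
      Nat.add_sub_cancel]
    rcases b with ⟨m, hm⟩ | ⟨i, hi⟩ | s
    · have hS : (Sum.inl ⟨m, hm⟩ : QVert (k + 1)) ≠ Sextra (k + 1) := by
        unfold Sextra; split <;> simp
      have hS2 : (Sum.inl ⟨m, hm⟩ : QVert (k + 1)) ≠ Qspecial2 (k + 1) := by
        simp [Qspecial2]
      simp only [fQ, hS, hS2, Sum.inl.injEq, Fin.mk.injEq, false_or, or_false]
      rcases lt_trichotomy m k with h | h | h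
      · left
        exact ⟨Or.inr (h5 _ (Or.inr ⟨m, h, Or.inl rfl⟩)), by omega⟩
      · right
        subst h
        exact ⟨h3.1, h3.2.1, h3.2.2, rfl⟩
      · left
        obtain rfl : m = k + 1 := by omega
        exact ⟨Or.inl h1, by omega⟩
    · simp only [fQ]
      by_cases h : i = k
      · right
        subst h
        refine ⟨h2.1, h2.2.1, h2.2.2, Or.inl (by simp [Qspecial2])⟩
      · by_cases h' : i + 1 = k
        · right
          subst h'
          refine ⟨h4.1, h4.2.1, h4.2.2, Or.inr (Or.inr (by simp [Sextra]))⟩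
        · left
          refine ⟨Or.inr (h5 _ (Or.inr ⟨i + 1, by omega, Or.inr rfl⟩)), ?_⟩
          unfold Sextra
          rw [dif_neg (by omega)]
          simp [Qspecial2]
          omega
    · fin_cases s
      · rcases Nat.eq_zero_or_pos k with rfl | hk
        · right
          exact ⟨h4.1, h4.2.1, h4.2.2, Or.inr (Or.inr rfl)⟩
        · left
          refine ⟨Or.inr (h5 _ (Or.inr ⟨0, hk, Or.inr rfl⟩)), ?_⟩
          unfold Sextra
          rw [dif_neg (by omega)]
          simp [Qspecial2]
      · left
        refine ⟨Or.inr (h5 _ (Or.inl rfl)), ?_⟩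
        unfold Sextra
        split <;> simp [Qspecial2]
  refine induced_of_match hG (Sum.elim (fQ (k + 1) vs ws (ws 0) l) (fun _ : Unit => z)) ?_
  rintro (a | a) (b | b) hne
  · exact Q_match hG hQ (Or.inr ⟨rfl, rfl⟩) a b (fun h => hne (by rw [h]))
  · exact (hc _ _).symm
  · exact hc _ _
  · exact absurd rfl hne

end MixedUnit


namespace MixedUnit

/-- The graph is twin-free and has none of the forbidden induced subgraphs. -/
structure Free {V : Type*} (G : SimpleGraph V) : Prop where
  tf : TwinFree G
  k : ¬ HasInducedSubgraph G K23star
  r : ∀ i : ℕ, ¬ HasInducedSubgraph G (Rgraph i)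
  s : ∀ i : ℕ, 1 ≤ i → ¬ HasInducedSubgraph G (Sgraph i)
  s' : ∀ i : ℕ, 1 ≤ i → ¬ HasInducedSubgraph G (S'graph i)
  t : ∀ i j : ℕ, j ≤ i → ¬ HasInducedSubgraph G (Tgraph i j)

/-- `CH P k v x e`: there is a rightward chain ending in the pair `v, x` of special vertices of
an ordered `Q_k`, where `e` is the last nonspecial vertex. -/
inductive CH {V : Type*} (P : V → V → Prop) : ℕ → V → V → V → Prop
  | zero {c m l : V} : P l m → ¬ P l c → ¬ P c l → ¬ P c m → ¬ P m c → CH P 0 c m l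
  | succ {k : ℕ} {v x e y1 y2 : V} : CH P k v x e → P x y1 → P x y2 → ¬ P v y1 → ¬ P v y2 →
      ¬ P y1 y2 → ¬ P y2 y1 → y1 ≠ y2 → CH P (k + 1) y1 y2 v

section
variable {V : Type*} {G : SimpleGraph V} {P : V → V → Prop}

theorem CH.basic (hG : Good G P) {k : ℕ} {v x e : V} (h : CH P k v x e) :
    ¬ P v x ∧ ¬ P x v ∧ v ≠ x ∧ ¬ P e v ∧ ¬ P v e ∧ e ≠ v := by
  induction h with
  | zero h1 h2 h3 h4 h5 =>
    refine ⟨h4, h5, ?_, h2, h3, ?_⟩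
    · rintro rfl; exact h2 h1
    · rintro rfl; exact h4 h1
  | succ h h1 h2 h3 h4 h5 h6 h7 ih =>
    refine ⟨h5, h6, h7, h3, ?_, ?_⟩
    · intro h8; exact ih.2.1 (hG.trans h1 h8)
    · rintro rfl; exact ih.2.1 h1

theorem CH.ex (hG : Good G P) {k : ℕ} {v x e : V} (h : CH P (k + 1) v x e) :
    ¬ P e x ∧ ¬ P x e := by
  cases h with
  | succ h h1 h2 h3 h4 h5 h6 h7 =>
    exact ⟨h4, fun h8 => (h.basic hG).2.1 (hG.trans h2 h8)⟩

/-- extend a sequence -/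
def ext (k : ℕ) (vs : ℕ → V) (y : V) : ℕ → V := fun i => if i ≤ k then vs i else y

theorem ext_le {k : ℕ} {vs : ℕ → V} {y : V} {i : ℕ} (h : i ≤ k) : ext k vs y i = vs i :=
  if_pos h

theorem ext_succ {k : ℕ} {vs : ℕ → V} {y : V} : ext k vs y (k + 1) = y :=
  if_neg (by omega)

theorem NS_ext {k : ℕ} {vs ws : ℕ → V} {y1 y2 l n : V} :
    NS k (ext k vs y1) (ext k ws y2) l n ↔ NS k vs ws l n := by
  unfold NS
  apply or_congr_right
  constructor
  · rintro ⟨i, hi, h⟩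
    rw [ext_le hi.le, ext_le hi.le] at h
    exact ⟨i, hi, h⟩
  · rintro ⟨i, hi, h⟩
    refine ⟨i, hi, ?_⟩
    rw [ext_le hi.le, ext_le hi.le]
    exact h

theorem QSeq.extend (hG : Good G P) {k : ℕ} {vs ws : ℕ → V} {l : V} (hQ : QSeq P k vs ws l)
    {y1 y2 : V} (h1 : P (ws k) y1) (h2 : P (ws k) y2) (h3 : ¬ P (vs k) y1) (h4 : ¬ P (vs k) y2)
    (h5 : ¬ P y1 y2) (h6 : ¬ P y2 y1) (h7 : y1 ≠ y2)
    (h8 : ∀ n, NS k vs ws l n → P n y1 ∧ P n y2) :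
    QSeq P (k + 1) (ext k vs y1) (ext k ws y2) l := by
  have hb := hQ.vw k le_rfl
  have hw : ∀ i, i ≤ k → P (ws i) y1 ∧ P (ws i) y2 := fun i hi => by
    rcases Nat.lt_or_ge i k with h | h
    · exact h8 _ (Or.inr ⟨i, h, Or.inr rfl⟩)
    · rw [le_antisymm hi h]; exact ⟨h1, h2⟩
  constructor
  · intro j hj
    rcases Nat.lt_or_ge k j with h | h
    · obtain rfl : j = k + 1 := by omega
      rw [ext_succ]; exact (h8 l (Or.inl rfl)).2
    · rw [ext_le h]; exact hQ.lw j h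
  · intro j hj hj0
    rcases Nat.lt_or_ge k j with h | h
    · obtain rfl : j = k + 1 := by omega
      rw [ext_succ]; exact (h8 l (Or.inl rfl)).1
    · rw [ext_le h]; exact hQ.lv j h hj0
  · rw [ext_le (Nat.zero_le _)]; exact hQ.l0
  · intro i j hij hj
    rw [ext_le (show i ≤ k by omega)]
    rcases Nat.lt_or_ge k j with h | h
    · obtain rfl : j = k + 1 := by omega
      rw [ext_succ]; exact (hw i (by omega)).1
    · rw [ext_le h]; exact hQ.wv i j hij h
  · intro i j hij hj
    rw [ext_le (show i ≤ k by omega)]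
    rcases Nat.lt_or_ge k j with h | h
    · obtain rfl : j = k + 1 := by omega
      rw [ext_succ]; exact (hw i (by omega)).2
    · rw [ext_le h]; exact hQ.ww i j hij h
  · intro i hi
    rcases Nat.lt_or_ge k i with h | h
    · obtain rfl : i = k + 1 := by omega
      rw [ext_succ, ext_succ]; exact ⟨h5, h6, h7⟩
    · rw [ext_le h, ext_le h]; exact hQ.vw i h
  · intro i hi
    rw [ext_le (show i ≤ k by omega)]
    rcases Nat.lt_or_ge i k with h | h
    · rw [ext_le (show i + 1 ≤ k by omega)]; exact hQ.v1 i h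
    · obtain rfl : i = k := by omega
      rw [ext_succ]
      refine ⟨h3, fun h9 => hb.2.1 (hG.trans h1 h9), fun h9 => ?_⟩
      rw [← h9] at h1
      exact hb.2.1 h1
  · intro i hi
    rw [ext_le (show i ≤ k by omega)]
    rcases Nat.lt_or_ge i k with h | h
    · rw [ext_le (show i + 1 ≤ k by omega)]; exact hQ.w1 i h
    · obtain rfl : i = k := by omega
      rw [ext_succ]
      refine ⟨h4, fun h9 => hb.2.1 (hG.trans h2 h9), fun h9 => ?_⟩
      rw [← h9] at h2
      exact hb.2.1 h2
  · intro i j hij hj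
    rw [ext_le (show i ≤ k by omega)]
    rcases Nat.lt_or_ge k j with h | h
    · obtain rfl : j = k + 1 := by omega
      rw [ext_succ]; exact (h8 _ (Or.inr ⟨i, by omega, Or.inl rfl⟩)).1
    · rw [ext_le h]; exact hQ.v2 i j hij h
  · intro i j hij hj
    rw [ext_le (show i ≤ k by omega)]
    rcases Nat.lt_or_ge k j with h | h
    · obtain rfl : j = k + 1 := by omega
      rw [ext_succ]; exact (h8 _ (Or.inr ⟨i, by omega, Or.inl rfl⟩)).2
    · rw [ext_le h]; exact hQ.w2 i j hij h

/-- A chain gives an ordered `Q_k`, and the last nonspecial vertex precedes everything that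
separates the special vertices. -/
theorem CH.seq (hG : Good G P) (hF : Free G) {k : ℕ} {v x e : V} (h : CH P k v x e) :
    (∃ vs ws l, QSeq P k vs ws l ∧ vs k = v ∧ ws k = x ∧
      ∀ n, NS k vs ws l n → ∀ z, P e z → P n z) ∧
    ∀ y, P x y → ¬ P v y → P e y := by
  induction h with
  | @zero c m l h1 h2 h3 h4 h5 =>
    have hlc : l ≠ c := by rintro rfl; exact h4 h1
    have hcm : c ≠ m := by rintro rfl; exact h2 h1
    refine ⟨⟨fun _ => c, fun _ => m, l, ?_, rfl, rfl, ?_⟩, fun y h6 _ => hG.trans h1 h6⟩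
    · constructor <;> (intros; first | omega | tauto)
    · rintro n (rfl | ⟨i, hi, _⟩) z hz
      · exact hz
      · omega
  | @succ k v x e y1 y2 h h1 h2 h3 h4 h5 h6 h7 ih =>
    obtain ⟨⟨vs, ws, l, hQ, rfl, rfl, hN⟩, hJ⟩ := ih
    have hN1 : ∀ n, NS k vs ws l n → P n y1 ∧ P n y2 := fun n hn =>
      ⟨hN n hn _ (hJ y1 h1 h3), hN n hn _ (hJ y2 h2 h4)⟩
    refine ⟨⟨ext k vs y1, ext k ws y2, l, hQ.extend hG h1 h2 h3 h4 h5 h6 h7 hN1, ext_succ,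
      ext_succ, ?_⟩, ?_⟩
    · have key : ∀ n, P n y1 → ∀ z, P (vs k) z → P n z := fun n hn z hz =>
        (hG.io _ _ _ _ hn hz).resolve_right h3
      rintro n (rfl | ⟨i, hi, hn⟩) z hz
      · exact key _ (hN1 _ (Or.inl rfl)).1 z hz
      · rw [ext_le (show i ≤ k by omega), ext_le (show i ≤ k by omega)] at hn
        rcases Nat.lt_or_ge i k with h' | h'
        · exact key _ (hN1 _ (Or.inr ⟨i, h', hn⟩)).1 z hz
        · obtain rfl : i = k := by omega
          rcases hn with rfl | rfl
          · exact hz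
          · exact key _ h1 z hz
    · intro y hy hy'
      by_contra hc
      refine hF.r k (R_induced hG hQ h2 (hG.trans h2 hy) h4 hc ?_ ?_ hy)
      · intro i hi
        exact (hN1 _ (Or.inr ⟨i, hi, Or.inl rfl⟩)).2
      · intro i hi
        exact hG.trans (hN1 _ (Or.inr ⟨i, hi, Or.inl rfl⟩)).2 hy

theorem CH.J (hG : Good G P) (hF : Free G) {k : ℕ} {v x e : V} (h : CH P k v x e)
    {y : V} (h1 : P x y) (h2 : ¬ P v y) : P e y := (h.seq hG hF).2 y h1 h2

theorem CH.R (hG : Good G P) (hF : Free G) {k : ℕ} {v x e : V} (h : CH P k v x e)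
    {y1 y2 : V} (h1 : P x y1) (h2 : P x y2) (h3 : ¬ P v y1) (h4 : ¬ P v y2) : ¬ P y1 y2 := by
  intro h5
  obtain ⟨⟨vs, ws, l, hQ, rfl, rfl, hN⟩, hJ⟩ := h.seq hG hF
  refine hF.r k (R_induced hG hQ h1 h2 h3 h4 ?_ ?_ h5)
  · intro i hi
    exact hN _ (Or.inr ⟨i, hi, Or.inl rfl⟩) _ (hJ _ h1 h3)
  · intro i hi
    exact hN _ (Or.inr ⟨i, hi, Or.inl rfl⟩) _ (hJ _ h2 h4)

theorem CH.S' (hG : Good G P) (hF : Free G) {k : ℕ} {v x e : V} (h : CH P k v x e)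
    {y1 y2 y3 : V} (h1 : P x y1) (h2 : P x y2) (h3 : P x y3) (h4 : ¬ P v y1) (h5 : ¬ P v y2)
    (h6 : ¬ P v y3) (h12 : y1 ≠ y2) (h13 : y3 ≠ y1) (h23 : y3 ≠ y2) : False := by
  have hb := h.basic hG
  have r12 := h.R hG hF h1 h2 h4 h5
  have r21 := h.R hG hF h2 h1 h5 h4
  have r13 := h.R hG hF h1 h3 h4 h6
  have r31 := h.R hG hF h3 h1 h6 h4
  have r23 := h.R hG hF h2 h3 h5 h6
  have r32 := h.R hG hF h3 h2 h6 h5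
  obtain ⟨⟨vs, ws, l, hQ, rfl, rfl, hN⟩, hJ⟩ := h.seq hG hF
  have hQ' := hQ.extend hG h1 h2 h4 h5 r12 r21 h12 (fun n hn =>
    ⟨hN n hn _ (hJ _ h1 h4), hN n hn _ (hJ _ h2 h5)⟩)
  refine hF.s' (k + 1) (by omega) (S'_induced hG hQ' (z := y3) ?_ ?_ ?_ ?_ ?_)
  · rw [ext_succ]; exact ⟨r31, r13, h13⟩
  · rw [ext_succ]; exact ⟨r32, r23, h23⟩
  · rw [ext_le le_rfl]
    refine ⟨fun h => hb.2.1 (hG.trans h3 h), h6, ?_⟩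
    rintro rfl
    exact hb.2.1 h3
  · rw [ext_le le_rfl]; exact h3
  · intro n hn
    exact hN n (NS_ext.1 hn) _ (hJ _ h3 h6)

theorem CH.S (hG : Good G P) (hF : Free G) {k : ℕ} {v x e : V} (h : CH P k v x e)
    {y1 y2 z : V} (h1 : P x y1) (h2 : P x y2) (h4 : ¬ P v y1) (h5 : ¬ P v y2)
    (hz1 : P z y1) (hz2 : ¬ P z y2) (hez : P e z) : False := by
  have hb := h.basic hG
  have r12 := h.R hG hF h1 h2 h4 h5
  have r21 := h.R hG hF h2 h1 h5 h4
  have h12 : y1 ≠ y2 := by rintro rfl; exact hz2 hz1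
  have hvz : ¬ P v z := fun h9 => h4 (hG.trans h9 hz1)
  have hzv : ¬ P z v := fun h9 => by
    rcases hG.io _ _ _ _ h9 h2 with h9 | h9
    · exact hz2 h9
    · exact hb.2.1 h9
  have hxz : ¬ P x z := fun h9 => h.R hG hF h9 h1 hvz h4 hz1
  have hzx : ¬ P z x := fun h9 => hz2 (hG.trans h9 h2)
  have h2z : ¬ P y2 z := fun h9 => r21 (hG.trans h9 hz1)
  have n1 : z ≠ y2 := by rintro rfl; exact hxz h2
  have n2 : z ≠ v := by rintro rfl; exact h4 hz1
  have n3 : z ≠ x := by rintro rfl; exact hz2 h2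
  obtain ⟨⟨vs, ws, l, hQ, rfl, rfl, hN⟩, hJ⟩ := h.seq hG hF
  have hQ' := hQ.extend hG h1 h2 h4 h5 r12 r21 h12 (fun n hn =>
    ⟨hN n hn _ (hJ _ h1 h4), hN n hn _ (hJ _ h2 h5)⟩)
  refine hF.s (k + 1) (by omega) (S_induced hG hQ' (z := z) ?_ ?_ ?_ ?_ ?_)
  · rw [ext_succ]; exact hz1
  · rw [ext_succ]; exact ⟨hz2, h2z, n1⟩
  · rw [ext_le le_rfl]
    exact ⟨hzv, hvz, n2⟩
  · rw [ext_le le_rfl]; exact ⟨hzx, hxz, n3⟩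
  · intro n hn
    exact hN n (NS_ext.1 hn) _ hez

/-- A rightward and a leftward chain cannot collide in the same vertex. -/
theorem lemC (hG : Good G P) (hF : Free G) {j : ℕ} {a d e' : V}
    (h' : CH (fun a b => P b a) j a d e') :
    ∀ {k : ℕ} {b e : V}, CH P k a b e → P b d → False := by
  induction h' with
  | @zero a d r h1 h2 h3 h4 h5 =>
    intro k b e h hbd
    exact h.R hG hF hbd (hG.trans hbd h1) h5 h2 h1
  | @succ j q0 q0' e0 a d h0 h1 h2 h3 h4 h5 h6 h7 ih =>
    intro k b e h hbd
    have hb := h.basic hG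
    have hb0 := h0.basic hG.swap
    have hc := CH.succ h0 h1 h2 h3 h4 h5 h6 h7
    have hbq : P b q0 := hc.J hG.swap hF (y := b) hbd hb.2.1
    have hq0d : ¬ P q0 d := fun h9 => hb0.2.1 (hG.trans h9 h2)
    have n : q0 ≠ d := by rintro rfl; exact hb0.2.1 h2
    exact ih (CH.succ h hbq hbd h3 h6 hq0d h4 n) h2

theorem lemD_aux (hG : Good G P) (hF : Free G) {k : ℕ} {v x e y z : V} (h : CH P k v x e)
    (hc : ∀ k', k = k' + 1 → ∀ v x e q y e', CH P k' v x e → CH (fun a b => P b a) 0 q y e' →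
      P x y → ¬ P v y → ¬ P x q → False)
    (h1 : P x y) (h2 : ¬ P v y) (h3 : ¬ P z y) (h4 : ¬ P y z) : z = v ∨ P e z := by
  have hb := h.basic hG
  cases h with
  | zero a1 a2 a3 a4 a5 =>
    by_contra hcon
    push Not at hcon
    refine hF.k (K_induced hG a3 a2 h2 (fun h9 => a5 (hG.trans h1 h9)) (d := z) ?_ hcon.2
      h3 h4 a1 h1 (Ne.symm hcon.1))
    exact fun h9 => h3 (hG.trans h9 (hG.trans a1 h1))
  | @succ k' v0 x0 e0 _ _ h0 a1 a2 a3 a4 a5 a6 a7 =>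
    by_contra hcon
    push Not at hcon
    obtain ⟨n1, n2⟩ := hcon
    have hb0 := h0.basic hG
    by_cases hx : P x0 z
    · refine h0.S' hG hF a1 a2 hx a3 a4 n2 a7 n1 ?_
      rintro rfl
      exact h3 h1
    · refine hc k' rfl e x0 e0 z x y h0 (CH.zero h1 h3 h4 ?_ ?_) a2 a4 hx
      · exact fun h9 => hx (hG.trans a2 h9)
      · exact fun h9 => h3 (hG.trans h9 h1)

theorem conf_aux (hF : Free G) : ∀ n : ℕ, ∀ P : V → V → Prop, Good G P →
    ∀ k j v x e q y e', k + j = n → CH P k v x e → CH (fun a b => P b a) j q y e' →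
      P x y → ¬ P v y → ¬ P x q → False := by
  intro n
  induction n using Nat.strong_induction_on with
  | _ n ih =>
    intro P hG k j v x e q y e' hn h h' hxy hvy hxq
    have hb := h.basic hG
    have hb' := h'.basic hG.swap
    have hqv : ¬ P q v := fun h9 => by
      rcases hG.io _ _ _ _ h9 hxy with h9 | h9
      · exact hb'.2.1 h9
      · exact hb.2.1 h9
    have hvq : ¬ P v q := fun h9 => by
      rcases hG.io _ _ _ _ h9 hxy with h9 | h9
      · exact hvy h9
      · exact hxq h9
    have hyv : ¬ P y v := fun h9 => hb.2.1 (hG.trans hxy h9)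
    have hqx : ¬ P q x := fun h9 => hb'.2.1 (hG.trans h9 hxy)
    by_cases hne : v = q
    · subst hne
      exact lemC hG hF h' h hxy
    have hD := lemD_aux hG hF h (z := q) (y := y) (by
      intro k' hk' v x e q y e' c1 c2 c3 c4 c5
      exact ih k' (by omega) P hG k' 0 v x e q y e' (by omega) c1 c2 c3 c4 c5)
      hxy hvy hb'.2.1 hb'.1
    have hD' := lemD_aux hG.swap hF h' (z := v) (y := x) (by
      intro k' hk' v x e q y e' c1 c2 c3 c4 c5
      exact ih k' (by omega) _ hG.swap k' 0 v x e q y e' (by omega) c1 c2 c3 c4 c5)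
      hxy hxq hb.2.1 hb.1
    have heq := hD.resolve_left (Ne.symm hne)
    have hve' := hD'.resolve_left hne
    have hey := h.J hG hF hxy hvy
    have hxe' := h'.J hG.swap hF (y := x) hxy hxq
    have n2 : v ≠ y := by rintro rfl; exact hb.2.1 hxy
    have n3 : x ≠ q := by rintro rfl; exact hb'.2.1 hxy
    obtain ⟨⟨vs, ws, l, hQ, rfl, rfl, hN⟩, -⟩ := h.seq hG hF
    obtain ⟨⟨vs', ws', l', hQ', rfl, rfl, hN'⟩, -⟩ := h'.seq hG.swap hF
    have h7 : ∀ n n', NS k vs ws l n → NS j vs' ws' l' n' → P n n' := by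
      intro n n' hn hn'
      apply hN' n' hn'
      exact (hG.io _ _ _ _ (hN n hn _ heq) hve').resolve_right hvq
    rcases Nat.le_total j k with hjk | hjk
    · refine hF.t k j hjk (T_induced hG hQ hQ' ⟨hvq, hqv, hne⟩ ⟨hvy, hyv, n2⟩ ⟨hxq, hqx, n3⟩ hxy
        (fun n hn => ⟨hN n hn _ heq, hN n hn _ hey⟩)
        (fun n hn => ⟨hN' n hn _ hve', hN' n hn _ hxe'⟩) h7)
    · refine hF.t j k hjk (T_induced hG.swap hQ' hQ ⟨hvq, hqv, Ne.symm hne⟩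
        ⟨hxq, hqx, n3.symm⟩ ⟨hvy, hyv, n2.symm⟩ hxy
        (fun n hn => ⟨hN' n hn _ hve', hN' n hn _ hxe'⟩)
        (fun n hn => ⟨hN n hn _ heq, hN n hn _ hey⟩) (fun n n' hn hn' => h7 n' n hn' hn))

theorem conf (hG : Good G P) (hF : Free G) {k j : ℕ} {v x e q y e' : V}
    (h : CH P k v x e) (h' : CH (fun a b => P b a) j q y e')
    (h1 : P x y) (h2 : ¬ P v y) (h3 : ¬ P x q) : False :=
  conf_aux hF _ P hG k j v x e q y e' rfl h h' h1 h2 h3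

theorem lemD (hG : Good G P) (hF : Free G) {k : ℕ} {v x e y z : V} (h : CH P k v x e)
    (h1 : P x y) (h2 : ¬ P v y) (h3 : ¬ P z y) (h4 : ¬ P y z) : z = v ∨ P e z :=
  lemD_aux hG hF h (fun _ _ _ _ _ _ _ _ c1 c2 c3 c4 c5 => conf hG hF c1 c2 c3 c4 c5) h1 h2 h3 h4

/-- All vertices separating the special vertices have the same predecessors. -/
theorem sameL (hG : Good G P) (hF : Free G) {k : ℕ} {v x e y1 y2 z : V} (h : CH P k v x e)
    (h1 : P x y1) (h2 : P x y2) (h3 : ¬ P v y1) (h4 : ¬ P v y2) (h5 : P z y1) : P z y2 := by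
  by_contra hc
  have h2z : ¬ P y2 z := fun h9 => h.R hG hF h2 h1 h4 h3 (hG.trans h9 h5)
  rcases lemD hG hF h h2 h4 hc h2z with rfl | h6
  · exact h3 h5
  · exact h.S hG hF h1 h2 h3 h4 h5 hc h6

end

end MixedUnit


namespace MixedUnit

open Set

/-! ## Greedy placement of the main vertices -/

theorem pos_exists {V : Type*} (lt Pr T : V → V → Prop) (M : V → Prop) (f : V → ℕ)
    (hf : ∀ p q, M p → M q → lt p q → f p < f q)
    (tot : ∀ p q, M p → M q → p ≠ q → lt p q ∨ lt q p)
    (A1 : ∀ p' p q, M p' → M p → M q → lt p' p → Pr p q → Pr p' q)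
    (A2 : ∀ p q q', M p → M q → M q' → lt q q' → Pr p q → Pr p q')
    (PT : ∀ p q, M p → M q → T p q → ¬ Pr p q)
    (T1 : ∀ p' p q, M p' → M p → M q → lt p' p → T p q → Pr p' q)
    (T2 : ∀ p q q', M p → M q → M q' → lt q q' → T p q → Pr p q')
    (s : Finset V) (hs : ∀ p ∈ s, M p) :
    ∃ pos : V → ℝ, ∀ p ∈ s, ∀ q ∈ s, lt p q → pos p < pos q ∧ (Pr p q → pos p + 1 < pos q) ∧
      (T p q → pos q = pos p + 1) ∧ (¬ Pr p q → ¬ T p q → pos q < pos p + 1) := by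
  classical
  induction s using Finset.induction_on_max_value f with
  | empty => exact ⟨fun _ => 0, by simp⟩
  | insert a s has hmax ih =>
    have hM : ∀ p ∈ s, M p := fun p hp => hs p (Finset.mem_insert_of_mem hp)
    have hMa : M a := hs a (Finset.mem_insert_self _ _)
    obtain ⟨pos, hpos⟩ := ih hM
    have hlt : ∀ p ∈ s, lt p a := by
      intro p hp
      rcases tot p a (hM p hp) hMa (fun h => has (h ▸ hp)) with h | h
      · exact h
      · have := hf _ _ hMa (hM p hp) h
        have := hmax p hp
        omega
    have hnlt : ∀ p ∈ s, ¬ lt a p := by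
      intro p hp h
      have := hf _ _ hMa (hM p hp) h
      have := hmax p hp
      omega
    suffices h : ∃ r : ℝ, ∀ p ∈ s, pos p < r ∧ (Pr p a → pos p + 1 < r) ∧
        (T p a → r = pos p + 1) ∧ (¬ Pr p a → ¬ T p a → r < pos p + 1) by
      obtain ⟨r, hr⟩ := h
      refine ⟨Function.update pos a r, ?_⟩
      intro p hp q hq hpq
      rw [Finset.mem_insert] at hp hq
      rcases hp with rfl | hp
      · rcases hq with rfl | hq
        · have := hf _ _ hMa hMa hpq
          omega
        · exact absurd hpq (hnlt q hq)
      · have hpa : p ≠ a := fun h => has (h ▸ hp)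
        rw [Function.update_of_ne hpa]
        rcases hq with rfl | hq
        · rw [Function.update_self]
          exact hr p hp
        · have hqa : q ≠ a := fun h => has (h ▸ hq)
          rw [Function.update_of_ne hqa]
          exact hpos p hp q hq hpq
    by_cases hT : ∃ b ∈ s, T b a
    · obtain ⟨b, hb, hba⟩ := hT
      have hnP := PT b a (hM b hb) hMa hba
      refine ⟨pos b + 1, fun c hc => ?_⟩
      by_cases hcb : c = b
      · subst hcb
        exact ⟨by linarith, fun h => absurd h hnP, fun _ => rfl, fun _ h => absurd hba h⟩
      rcases tot c b (hM c hc) (hM b hb) hcb with h | h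
      · have h1 := T1 c b a (hM c hc) (hM b hb) hMa h hba
        have h2 := (hpos c hc b hb h).1
        exact ⟨by linarith, fun _ => by linarith, fun h3 => absurd h1 (PT _ _ (hM c hc) hMa h3),
          fun h3 => absurd h1 h3⟩
      · have h1 : ¬ Pr c a := fun h1 => hnP (A1 b c a (hM b hb) (hM c hc) hMa h h1)
        have h2 : ¬ T c a := fun h1 => hnP (T1 b c a (hM b hb) (hM c hc) hMa h h1)
        have h3 : ¬ Pr b c := fun h1 => hnP (A2 b c a (hM b hb) (hM c hc) hMa (hlt c hc) h1)
        have h4 : ¬ T b c := fun h1 => hnP (T2 b c a (hM b hb) (hM c hc) hMa (hlt c hc) h1)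
        obtain ⟨h5, -, -, h6⟩ := hpos b hb c hc h
        have h7 := h6 h3 h4
        exact ⟨h7, fun h => absurd h h1, fun h => absurd h h2, fun _ _ => by linarith⟩
    · push Not at hT
      obtain ⟨r, hr1, hr2⟩ := Order.exists_between_finsets
        (s.image pos ∪ (s.filter (fun b => Pr b a)).image (fun b => pos b + 1))
        ((s.filter (fun c => ¬ Pr c a)).image (fun c => pos c + 1)) (by
          intro x hx y hy
          simp only [Finset.mem_image, Finset.mem_filter] at hy
          obtain ⟨c, ⟨hc, hca⟩, rfl⟩ := hy
          simp only [Finset.mem_union, Finset.mem_image, Finset.mem_filter] at hx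
          rcases hx with ⟨b, hb, rfl⟩ | ⟨b, ⟨hb, hba⟩, rfl⟩
          · by_cases hcb : b = c
            · subst hcb; linarith
            rcases tot b c (hM b hb) (hM c hc) hcb with h | h
            · have := (hpos b hb c hc h).1
              linarith
            · have h3 : ¬ Pr c b := fun h1 => hca (A2 c b a (hM c hc) (hM b hb) hMa (hlt b hb) h1)
              have h4 : ¬ T c b := fun h1 => hca (T2 c b a (hM c hc) (hM b hb) hMa (hlt b hb) h1)
              exact (hpos c hc b hb h).2.2.2 h3 h4
          · have hcb : b ≠ c := by rintro rfl; exact hca hba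
            rcases tot b c (hM b hb) (hM c hc) hcb with h | h
            · have := (hpos b hb c hc h).1
              linarith
            · exact absurd (A1 c b a (hM c hc) (hM b hb) hMa h hba) hca)
      refine ⟨r, fun p hp => ⟨?_, fun h => ?_, fun h => absurd h (hT p hp), fun h _ => ?_⟩⟩
      · exact hr1 _ (Finset.mem_union_left _ (Finset.mem_image_of_mem _ hp))
      · exact hr1 (pos p + 1) (Finset.mem_union_right _ (Finset.mem_image.2
          ⟨p, Finset.mem_filter.2 ⟨hp, h⟩, rfl⟩))
      · exact hr2 (pos p + 1) (Finset.mem_image.2 ⟨p, Finset.mem_filter.2 ⟨hp, h⟩, rfl⟩)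

/-- Unit interval with prescribed behaviour at the end points. -/
def UI (c : ℝ) (l r : Prop) : Set ℝ := {t | c ≤ t ∧ t ≤ c + 1 ∧ (t = c → l) ∧ (t = c + 1 → r)}

theorem UI_isUnit (c : ℝ) (l r : Prop) : IsUnitInterval (UI c l r) := by
  refine ⟨c, ?_⟩
  by_cases hl : l <;> by_cases hr : r
  · left; ext t; simp [UI, hl, hr]
  · right; right; right; ext t
    simp only [UI, hl, hr, mem_setOf_eq, mem_Ico]
    constructor
    · rintro ⟨h1, h2, -, h3⟩
      exact ⟨h1, lt_of_le_of_ne h2 h3⟩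
    · rintro ⟨h1, h2⟩
      exact ⟨h1, h2.le, fun _ => trivial, fun h => h2.ne h⟩
  · right; right; left; ext t
    simp only [UI, hl, hr, mem_setOf_eq, mem_Ioc]
    constructor
    · rintro ⟨h1, h2, h3, -⟩
      exact ⟨lt_of_le_of_ne h1 (fun h => h3 h.symm), h2⟩
    · rintro ⟨h1, h2⟩
      exact ⟨h1.le, h2, fun h => h1.ne h.symm, fun h => trivial⟩
  · right; left; ext t
    simp only [UI, hl, hr, mem_setOf_eq, mem_Ioo]
    constructor
    · rintro ⟨h1, h2, h3, h4⟩
      exact ⟨lt_of_le_of_ne h1 (fun h => h3 h.symm), lt_of_le_of_ne h2 h4⟩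
    · rintro ⟨h1, h2⟩
      exact ⟨h1.le, h2.le, fun h => h1.ne h.symm, fun h => h2.ne h⟩

theorem isUnit_UI {s : Set ℝ} (h : IsUnitInterval s) : ∃ c l r, s = UI c l r := by
  obtain ⟨c, rfl | rfl | rfl | rfl⟩ := h
  · refine ⟨c, True, True, ?_⟩
    ext t; simp [UI]
  · refine ⟨c, False, False, ?_⟩
    ext t; simp only [UI, mem_setOf_eq, mem_Ioo]
    constructor
    · rintro ⟨h1, h2⟩
      exact ⟨h1.le, h2.le, fun h => h1.ne h.symm, fun h => h2.ne h⟩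
    · rintro ⟨h1, h2, h3, h4⟩
      exact ⟨lt_of_le_of_ne h1 (fun h => h3 h.symm), lt_of_le_of_ne h2 h4⟩
  · refine ⟨c, False, True, ?_⟩
    ext t; simp only [UI, mem_setOf_eq, mem_Ioc]
    constructor
    · rintro ⟨h1, h2⟩
      exact ⟨h1.le, h2, fun h => h1.ne h.symm, fun h => trivial⟩
    · rintro ⟨h1, h2, h3, -⟩
      exact ⟨lt_of_le_of_ne h1 (fun h => h3 h.symm), h2⟩
  · refine ⟨c, True, False, ?_⟩
    ext t; simp only [UI, mem_setOf_eq, mem_Ico]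
    constructor
    · rintro ⟨h1, h2⟩
      exact ⟨h1, h2.le, fun _ => trivial, fun h => h2.ne h⟩
    · rintro ⟨h1, h2, -, h3⟩
      exact ⟨h1, lt_of_le_of_ne h2 h3⟩

theorem UI_inter (c c' : ℝ) (l r l' r' : Prop) : (UI c l r ∩ UI c' l' r').Nonempty ↔
    (c < c' + 1 ∧ c' < c + 1) ∨ (c' = c + 1 ∧ r ∧ l') ∨ (c = c' + 1 ∧ r' ∧ l) := by
  constructor
  · rintro ⟨t, ⟨h1, h2, h3, h4⟩, ⟨h5, h6, h7, h8⟩⟩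
    rcases lt_trichotomy c' (c + 1) with h | h | h
    · rcases lt_trichotomy c (c' + 1) with h' | h' | h'
      · exact Or.inl ⟨h', h⟩
      · have e1 : t = c := by linarith
        have e2 : t = c' + 1 := by linarith
        exact Or.inr (Or.inr ⟨h', h8 e2, h3 e1⟩)
      · linarith
    · have e1 : t = c' := by linarith
      have e2 : t = c + 1 := by linarith
      exact Or.inr (Or.inl ⟨h, h4 e2, h7 e1⟩)
    · linarith
  · rintro (⟨h1, h2⟩ | ⟨h, hr, hl⟩ | ⟨h, hr, hl⟩)
    · refine ⟨(c + c' + 1) / 2, ⟨?_, ?_, ?_, ?_⟩, ⟨?_, ?_, ?_, ?_⟩⟩ <;>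
        first | linarith | (intro h; exfalso; linarith)
    · refine ⟨c', ⟨?_, ?_, ?_, ?_⟩, ⟨?_, ?_, ?_, ?_⟩⟩ <;>
        first | linarith | (intro h; first | assumption | (exfalso; linarith))
    · refine ⟨c, ⟨?_, ?_, ?_, ?_⟩, ⟨?_, ?_, ?_, ?_⟩⟩ <;>
        first | linarith | (intro h; first | assumption | (exfalso; linarith))

section
variable {V : Type*} {G : SimpleGraph V} {P : V → V → Prop}

/-- `x` is placed on top of `v`, open to the right. -/
def RP (P : V → V → Prop) (v x : V) : Prop := ∃ k e y, CH P k v x e ∧ P x y ∧ ¬ P v y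

/-- mirror image of `RP` -/
def LP (P : V → V → Prop) (v x : V) : Prop := RP (fun a b => P b a) v x

theorem RP.basic (hG : Good G P) {v x : V} (h : RP P v x) : ¬ P v x ∧ ¬ P x v ∧ v ≠ x := by
  obtain ⟨k, e, y, h, -⟩ := h
  have := h.basic hG
  exact ⟨this.1, this.2.1, this.2.2.1⟩

theorem RP.split (hG : Good G P) {v x : V} (h : RP P v x) :
    LP P v x ∨ ∃ k e y, CH P (k + 1) v x e ∧ P x y ∧ ¬ P v y := by
  obtain ⟨k, e, y, h, h1, h2⟩ := h
  rcases k with _ | k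
  · left
    cases h with
    | zero a1 a2 a3 a4 a5 =>
      exact ⟨0, y, e, CH.zero h1 h2 (fun h9 => a5 (hG.trans h1 h9)) a5 a4, a1, a2⟩
  · right
    exact ⟨k, e, y, h, h1, h2⟩

theorem RP.Usub (hG : Good G P) {v x z : V} (h : RP P v x) (hz : P v z) : P x z := by
  obtain ⟨k, e, y, h, h1, h2⟩ := h
  exact (hG.io _ _ _ _ hz h1).resolve_left h2

theorem RP.Lsub (hG : Good G P) (hF : Free G) {v x z : V} (h : RP P v x) (hz : P z v) :
    P z x := by
  obtain ⟨k, e, y, h, h1, h2⟩ := h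
  cases h with
  | zero a1 a2 a3 a4 a5 => exact (hG.io _ _ _ _ hz a1).resolve_right a2
  | succ h0 a1 a2 a3 a4 a5 a6 a7 => exact sameL hG hF h0 a1 a2 a3 a4 hz

theorem C1 (hG : Good G P) (hF : Free G) {v v' x : V} (h : RP P v x)
    (hL : ∀ z, P z v' → P z v) (hU : ∀ z, P v' z → P v z) : v' = v := by
  obtain ⟨k, e, y, h, h1, h2⟩ := h
  have hb := h.basic hG
  rcases lemD hG hF h h1 h2 (z := v') (fun h9 => h2 (hU _ h9))
    (fun h9 => hb.2.1 (hG.trans h1 (hL _ h9))) with h3 | h3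
  · exact h3
  · exact absurd (hL _ h3) hb.2.2.2.1

theorem Ltot (hG : Good G P) (p q : V) : (∀ z, P z p → P z q) ∨ (∀ z, P z q → P z p) := by
  by_contra hc
  push Not at hc
  obtain ⟨⟨z, h1, h2⟩, ⟨w, h3, h4⟩⟩ := hc
  rcases hG.io _ _ _ _ h1 h3 with h | h
  · exact h2 h
  · exact h4 h

theorem Utot (hG : Good G P) (p q : V) : (∀ z, P p z → P q z) ∨ (∀ z, P q z → P p z) :=
  Ltot hG.swap p q

theorem C2a_aux (hG : Good G P) (hF : Free G) {v v' x : V} (h : RP P v x) (h' : RP P v' x)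
    (hU : ∀ z, P v z → P v' z) : v = v' := by
  rcases Ltot hG v v' with hL | hL
  · exact C1 hG hF h' hL hU
  · obtain ⟨k, e, y, h, h1, h2⟩ := h
    obtain ⟨k', e', y', h', h1', h2'⟩ := h'
    have hb := h.basic hG
    have hb' := h'.basic hG
    rcases lemD hG hF h h1' (fun h9 => h2' (hU _ h9)) (z := v') h2'
      (fun h9 => hb'.2.1 (hG.trans h1' h9)) with h3 | h3
    · exact h3.symm
    · exact absurd (hL _ h3) hb.2.2.2.1

theorem C2a (hG : Good G P) (hF : Free G) {v v' x : V} (h : RP P v x) (h' : RP P v' x) :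
    v = v' := by
  rcases Utot hG v v' with hU | hU
  · exact C2a_aux hG hF h h' hU
  · exact (C2a_aux hG hF h' h hU).symm

theorem C2b (hG : Good G P) (hF : Free G) {v v' x : V} (h : RP P v x) (h' : LP P v' x) :
    v = v' := by
  by_contra hne
  have hU : ∀ z, P v z → P x z := fun z hz => h.Usub hG hz
  have hb := h.basic hG
  have hb' := RP.basic hG.swap h'
  rcases h.split hG with h1 | ⟨k, e, y, h, h1, h2⟩
  · exact hne (C2a hG.swap hF h1 h')
  rcases RP.split hG.swap h' with h1' | ⟨k', e', y', h', h1', h2'⟩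
  · exact hne (C2a hG hF ⟨_, _, _, h, h1, h2⟩ h1')
  cases h' with
  | @succ _ e' u e0 _ _ h0 a1 a2 a3 a4 a5 a6 a7 =>
    by_cases hvu : P v u
    · exact h0.S' hG.swap hF (y1 := v) hvu a1 a2 (fun h9 => a4 (hU _ h9)) a3 a4 hne
        (Ne.symm hb.2.2) a7.symm
    · exact conf hG hF h h0 a2 hvu a4

theorem C3 (hG : Good G P) (hF : Free G) {k : ℕ} {v x e y q : V} (h : CH P k v x e)
    (h1 : P x y) (h2 : ¬ P v y) (hq : LP P q y) : False := by
  by_cases hxq : P x q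
  · have hvq : ¬ P v q := fun h9 => h2 (RP.Usub hG.swap hq h9)
    obtain ⟨k', e', l, h', h1', h2'⟩ := hq
    exact h2' (sameL hG hF h h1 hxq h2 hvq h1')
  · obtain ⟨k', e', l, h', h1', h2'⟩ := hq
    exact conf hG hF h h' h1 h2 hxq

theorem F2 (hG : Good G P) (hF : Free G) {p x y z : V} (h : RP P p x) (h' : RP P p y)
    (hz : P x z) : P y z := by
  by_cases hpz : P p z
  · exact h'.Usub hG hpz
  obtain ⟨k, e, r, h, h1, h2⟩ := h
  obtain ⟨k', e', s, h', h1', h2'⟩ := h'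
  rcases hG.io _ _ _ _ hz h1' with h9 | h9
  · exact sameL hG hF h h9 hz h2' hpz h1'
  · exact h9

/-- main vertices -/
def Main (P : V → V → Prop) (p : V) : Prop := ∀ v, ¬ RP P v p ∧ ¬ LP P v p

theorem Main.swap {p : V} (h : Main P p) : Main (fun a b => P b a) p :=
  fun v => ⟨(h v).2, (h v).1⟩

theorem RP.main (hG : Good G P) (hF : Free G) {v x : V} (h : RP P v x) : Main P v := by
  refine fun v' => ⟨fun h' => ?_, fun h' => ?_⟩
  · exact (h'.basic hG).2.2 (C1 hG hF h (fun z hz => h'.Lsub hG hF hz) (fun z hz => h'.Usub hG hz))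
  · exact (RP.basic hG.swap h').2.2 (C1 hG hF h (fun z hz => RP.Usub hG.swap h' hz)
      (fun z hz => RP.Lsub hG.swap hF h' hz))

/-- right-open vertices -/
def RO (P : V → V → Prop) (x : V) : Prop := ∃ v, RP P v x

/-- left-open vertices -/
def LO (P : V → V → Prop) (x : V) : Prop := ∃ v, LP P v x

/-- `p` is the main vertex of `x` -/
def Mu (P : V → V → Prop) (x p : V) : Prop := RP P p x ∨ LP P p x ∨ (Main P x ∧ p = x)

theorem Mu.swap {x p : V} (h : Mu P x p) : Mu (fun a b => P b a) x p := by
  rcases h with h | h | ⟨h, h'⟩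
  · exact Or.inr (Or.inl h)
  · exact Or.inl h
  · exact Or.inr (Or.inr ⟨h.swap, h'⟩)

theorem Mu.ex (P : V → V → Prop) (x : V) : ∃ p, Mu P x p := by
  by_cases h : Main P x
  · exact ⟨x, Or.inr (Or.inr ⟨h, rfl⟩)⟩
  · unfold Main at h
    push Not at h
    obtain ⟨v, hv⟩ := h
    by_cases h1 : RP P v x
    · exact ⟨v, Or.inl h1⟩
    · exact ⟨v, Or.inr (Or.inl (hv h1))⟩

theorem Mu.main (hG : Good G P) (hF : Free G) {x p : V} (h : Mu P x p) : Main P p := by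
  rcases h with h | h | ⟨h, rfl⟩
  · exact h.main hG hF
  · exact Main.swap (RP.main hG.swap hF h)
  · exact h

theorem Mu.Usub (hG : Good G P) (hF : Free G) {x p z : V} (h : Mu P x p) (hz : P p z) :
    P x z := by
  rcases h with h | h | ⟨h, rfl⟩
  · exact h.Usub hG hz
  · exact RP.Lsub hG.swap hF h hz
  · exact hz

theorem Mu.Lsub (hG : Good G P) (hF : Free G) {x p z : V} (h : Mu P x p) (hz : P z p) :
    P z x := Mu.Usub hG.swap hF h.swap hz

theorem Mu.Leq (hG : Good G P) (hF : Free G) {x p z : V} (h : Mu P x p) (hx : ¬ LO P x)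
    (hz : P z x) : P z p := by
  rcases h with h | h | ⟨h, rfl⟩
  · rcases h.split hG with h | ⟨k, e, y, h, h1, h2⟩
    · exact absurd ⟨_, h⟩ hx
    · cases h with
      | succ h0 a1 a2 a3 a4 a5 a6 a7 => exact sameL hG hF h0 a2 a1 a4 a3 hz
  · exact absurd ⟨_, h⟩ hx
  · exact hz

theorem Mu.Ueq (hG : Good G P) (hF : Free G) {x p z : V} (h : Mu P x p) (hx : ¬ RO P x)
    (hz : P x z) : P p z := Mu.Leq hG.swap hF h.swap hx hz

theorem Mu.ro (hG : Good G P) (hF : Free G) {x p : V} (h : Mu P x p) (hx : RO P x) :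
    RP P p x := by
  obtain ⟨v, hv⟩ := hx
  rcases h with h | h | ⟨h, rfl⟩
  · exact h
  · rwa [← C2b hG hF hv h]
  · exact absurd hv (h v).1

theorem Mu.lo (hG : Good G P) (hF : Free G) {x p : V} (h : Mu P x p) (hx : LO P x) :
    LP P p x := Mu.ro hG.swap hF h.swap hx

/-- linear quasi-order on main vertices -/
def Le (P : V → V → Prop) (p q : V) : Prop := (∀ z, P z p → P z q) ∧ (∀ z, P q z → P p z)

theorem Le.swap {p q : V} (h : Le P p q) : Le (fun a b => P b a) q p := ⟨h.2, h.1⟩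

theorem Le.antisymm (hG : Good G P) (hF : Free G) {p q : V} (h : Le P p q) (h' : Le P q p) :
    p = q := by
  have hL : ∀ z, P z p ↔ P z q := fun z => ⟨h.1 z, h'.1 z⟩
  have hU : ∀ z, P p z ↔ P q z := fun z => ⟨h'.2 z, h.2 z⟩
  have key : ∀ a z, z ∈ insert a (G.neighborSet a) ↔ ¬ P a z ∧ ¬ P z a := by
    intro a z
    rw [Set.mem_insert_iff, SimpleGraph.mem_neighborSet, hG.adj]
    constructor
    · rintro (rfl | h)
      · exact ⟨hG.irr _, hG.irr _⟩
      · exact h.2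
    · intro h
      by_cases e : z = a
      · exact Or.inl e
      · exact Or.inr ⟨Ne.symm e, h⟩
  apply hF.tf
  ext z
  rw [key, key, hL, hU]

theorem Le.total_aux (hG : Good G P) {p q : V} (hq : Main P q)
    (h1 : ∀ z, P z p → P z q) (h2 : ∀ z, P p z → P q z) : Le P p q ∨ Le P q p := by
  by_contra hc
  unfold Le at hc
  push Not at hc
  obtain ⟨r, hr, hr'⟩ := hc.1 h1
  have : ∃ l, P l q ∧ ¬ P l p := by
    by_contra hl
    push Not at hl
    obtain ⟨s, hs, hs'⟩ := hc.2 hl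
    exact hs' (h2 _ hs)
  obtain ⟨l, hl, hl'⟩ := this
  refine (hq p).1 ⟨0, l, r, CH.zero hl hl' ?_ ?_ ?_, hr, hr'⟩
  · exact fun h9 => hG.irr q (hG.trans (h2 _ h9) hl)
  · exact fun h9 => hG.irr q (h2 _ h9)
  · exact fun h9 => hG.irr q (h1 _ h9)

theorem Le.total (hG : Good G P) {p q : V} (hp : Main P p) (hq : Main P q) :
    Le P p q ∨ Le P q p := by
  rcases Ltot hG p q with h1 | h1 <;> rcases Utot hG p q with h2 | h2
  · exact Le.total_aux hG hq h1 h2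
  · exact Or.inl ⟨h1, h2⟩
  · exact Or.inr ⟨h1, h2⟩
  · exact (Le.total_aux hG hp h1 h2).symm

/-- `q` separates `p` from a vertex on top of `p`. -/
def TR (P : V → V → Prop) (p q : V) : Prop := ∃ k x e, CH P k p x e ∧ P x q ∧ ¬ P p q

/-- `p` and `q` have to touch. -/
def Touch (P : V → V → Prop) (p q : V) : Prop := TR P p q ∨ TR (fun a b => P b a) q p

theorem Touch.swap {p q : V} (h : Touch P p q) : Touch (fun a b => P b a) q p := Or.symm h

theorem Touch.nP {p q : V} (h : Touch P p q) : ¬ P p q := by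
  rcases h with ⟨k, x, e, h, h1, h2⟩ | ⟨k, x, e, h, h1, h2⟩
  · exact h2
  · exact h2

theorem T1 (hG : Good G P) (hF : Free G) {p' p q : V} (hp : Main P p) (hle : Le P p' p)
    (hne : p' ≠ p) (h : Touch P p q) : P p' q := by
  by_contra hc
  rcases h with ⟨k, x, e, h, h1, h2⟩ | ⟨k, q', e, h, h1, h2⟩
  · have hb := h.basic hG
    rcases lemD hG hF h h1 h2 (z := p') hc
      (fun h9 => hb.2.1 (hG.trans h1 (hle.1 _ h9))) with h3 | h3
    · exact hne h3
    · exact hb.2.2.2.1 (hle.1 _ h3)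
  · have h3 : P p' q' := hle.2 _ h1
    have : ∃ l, P l p ∧ ¬ P l p' := by
      by_contra hl
      push Not at hl
      exact hne (Le.antisymm hG hF hle ⟨hl, fun z hz => sameL hG.swap hF h h3 h1 hc h2 hz⟩)
    obtain ⟨l, hl, hl'⟩ := this
    exact (hp p').2 ⟨k + 1, q, l, CH.succ h h3 h1 hc h2 (h.R hG.swap hF h3 h1 hc h2)
      (h.R hG.swap hF h1 h3 h2 hc) hne, hl, hl'⟩

theorem T2 (hG : Good G P) (hF : Free G) {p q q' : V} (hq : Main P q) (hle : Le P q q')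
    (hne : q' ≠ q) (h : Touch P p q) : P p q' :=
  T1 hG.swap hF hq.swap hle.swap hne h.swap

theorem C5 (hG : Good G P) (hF : Free G) {p q x : V} (h : RP P p x)
    (h' : TR (fun a b => P b a) q p) : P x q := by
  by_contra hc
  obtain ⟨k', q', e', h', h1', h2'⟩ := h'
  have h3 : P x q' := h.Usub hG h1'
  obtain ⟨k, e, y, h, h1, h2⟩ := h
  exact h2 (sameL hG.swap hF h' h3 h1' hc h2' h1)

theorem adj_fwd (hG : Good G P) (hF : Free G) {x y p q : V} (hx : Mu P x p) (hy : Mu P y q)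
    (h : P x y) : P p q ∨ (Touch P p q ∧ (RO P x ∨ LO P y)) := by
  by_cases hpq : P p q
  · exact Or.inl hpq
  right
  by_cases hrx : RO P x
  · refine ⟨?_, Or.inl hrx⟩
    obtain ⟨k, e, r, h0, h1, h2⟩ := hx.ro hG hF hrx
    by_cases hly : LO P y
    · have hqy := hy.lo hG hF hly
      by_cases hpy : P p y
      · obtain ⟨k', e', r', h0', h1', h2'⟩ := hqy
        exact Or.inr ⟨k', y, e', h0', hpy, hpq⟩
      · exact (C3 hG hF h0 h hpy hqy).elim
    · exact Or.inl ⟨k, x, e, h0, hy.Leq hG hF hly h, hpq⟩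
  · have hpy := hx.Ueq hG hF hrx h
    by_cases hly : LO P y
    · refine ⟨?_, Or.inr hly⟩
      obtain ⟨k', e', r', h0', h1', h2'⟩ := hy.lo hG hF hly
      exact Or.inr ⟨k', y, e', h0', hpy, hpq⟩
    · exact absurd (hy.Leq hG hF hly hpy) hpq

theorem adj_bwd_aux (hG : Good G P) (hF : Free G) {x y p q : V} (hx : Mu P x p) (hy : Mu P y q)
    (h : Touch P p q) (hr : RO P x) : P x y := by
  have hpx := hx.ro hG hF hr
  apply hy.Lsub hG hF
  rcases h with ⟨k, x1, e, h0, h1, h2⟩ | h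
  · exact F2 hG hF ⟨k, e, q, h0, h1, h2⟩ hpx h1
  · exact C5 hG hF hpx h

theorem adj_bwd (hG : Good G P) (hF : Free G) {x y p q : V} (hx : Mu P x p) (hy : Mu P y q)
    (h : P p q ∨ (Touch P p q ∧ (RO P x ∨ LO P y))) : P x y := by
  rcases h with h | ⟨h, h' | h'⟩
  · exact hy.Lsub hG hF (hx.Usub hG hF h)
  · exact adj_bwd_aux hG hF hx hy h h'
  · exact adj_bwd_aux hG.swap hF hy.swap hx.swap h.swap h'

theorem touch_not (hG : Good G P) {p q : V} (hle : Le P p q) (h : Touch P q p) : False := by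
  rcases h with ⟨k, x, e, h, h1, h2⟩ | ⟨k, x, e, h, h1, h2⟩
  · exact (h.basic hG).2.1 (hle.1 _ h1)
  · exact (h.basic hG.swap).2.1 (hle.2 _ h1)

theorem adj_not (hG : Good G P) (hF : Free G) {x y p q : V} (hx : Mu P x p) (hy : Mu P y q)
    (hle : Le P p q) : ¬ P y x := by
  intro h
  rcases adj_fwd hG hF hy hx h with h | ⟨h, -⟩
  · exact hG.irr q (hle.1 _ h)
  · exact touch_not hG hle h

/-- The main construction. -/
theorem mixed_of_good [Fintype V] (hG : Good G P) (hF : Free G) : MixedUnitIntervalGraph G := by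
  classical
  have hlt : ∀ p q r, Le P p q → Le P q r → Le P p r := fun p q r h1 h2 =>
    ⟨fun z hz => h2.1 z (h1.1 z hz), fun z hz => h1.2 z (h2.2 z hz)⟩
  obtain ⟨pos, hpos⟩ := pos_exists (fun p q => Le P p q ∧ p ≠ q) P (Touch P) (Main P)
    (fun p => (Finset.univ.filter (fun z => Le P z p)).card)
    (by
      rintro p q hp hq ⟨h1, h2⟩
      apply Finset.card_lt_card
      rw [Finset.ssubset_iff_of_subset]
      · refine ⟨q, ?_, ?_⟩
        · exact Finset.mem_filter.2 ⟨Finset.mem_univ _, fun _ h => h, fun _ h => h⟩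
        · simp only [Finset.mem_filter, Finset.mem_univ, true_and]
          exact fun h => h2 (Le.antisymm hG hF h1 h)
      · intro z hz
        simp only [Finset.mem_filter, Finset.mem_univ, true_and] at hz ⊢
        exact hlt _ _ _ hz h1)
    (by
      intro p q hp hq hne
      exact (Le.total hG hp hq).imp (fun h => ⟨h, hne⟩) (fun h => ⟨h, hne.symm⟩))
    (by
      rintro p' p q - - - ⟨h, -⟩ h1
      exact h.2 _ h1)
    (by
      rintro p q q' - - - ⟨h, -⟩ h1
      exact h.1 _ h1)
    (fun p q _ _ h => h.nP)
    (by
      rintro p' p q - hp - ⟨h, hne⟩ h1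
      exact T1 hG hF hp h hne h1)
    (by
      rintro p q q' - hq - ⟨h, hne⟩ h1
      exact T2 hG hF hq h hne.symm h1)
    (Finset.univ.filter (fun z => Main P z)) (by simp)
  simp only [Finset.mem_filter, Finset.mem_univ, true_and] at hpos
  choose mu hmu using Mu.ex P
  have hM : ∀ x, Main P (mu x) := fun x => (hmu x).main hG hF
  refine ⟨fun x => UI (pos (mu x)) (¬ LO P x) (¬ RO P x), ?_, fun v => UI_isUnit _ _ _⟩
  have key : ∀ u v, Le P (mu u) (mu v) → u ≠ v → (G.Adj u v ↔
      (UI (pos (mu u)) (¬ LO P u) (¬ RO P u) ∩ UI (pos (mu v)) (¬ LO P v) (¬ RO P v)).Nonempty) := by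
    intro u v hle hne
    have hnP := adj_not hG hF (hmu u) (hmu v) hle
    rw [hG.adj, UI_inter]
    by_cases hmm : mu u = mu v
    · have hle' : Le P (mu v) (mu u) := by rw [hmm]; exact ⟨fun _ h => h, fun _ h => h⟩
      have hnP' := adj_not hG hF (hmu v) (hmu u) hle'
      rw [hmm]
      exact ⟨fun _ => Or.inl ⟨by linarith, by linarith⟩, fun _ => ⟨hne, hnP', hnP⟩⟩
    · obtain ⟨p1, p2, p3, p4⟩ := hpos _ (hM u) _ (hM v) ⟨hle, hmm⟩
      have hiff : P u v ↔ P (mu u) (mu v) ∨ (Touch P (mu u) (mu v) ∧ (RO P u ∨ LO P v)) :=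
        ⟨adj_fwd hG hF (hmu u) (hmu v), adj_bwd hG hF (hmu u) (hmu v)⟩
      constructor
      · rintro ⟨-, h1, -⟩
        rw [hiff] at h1
        push Not at h1
        by_cases hT : Touch P (mu u) (mu v)
        · exact Or.inr (Or.inl ⟨p3 hT, h1.2 hT⟩)
        · exact Or.inl ⟨by linarith, p4 h1.1 hT⟩
      · intro h
        refine ⟨hne, ?_, hnP⟩
        rw [hiff]
        rintro (h1 | ⟨h1, h2⟩)
        · have := p2 h1
          rcases h with h | h | h <;> linarith [h.1, h.2]
        · have := p3 h1
          rcases h with h | h | h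
          · linarith [h.2]
          · exact h2.elim h.2.1 h.2.2
          · linarith [h.1]
  intro u v hne
  rcases Le.total hG (hM u) (hM v) with h | h
  · exact key u v h hne
  · rw [G.adj_comm, Set.inter_comm]
    exact key v u h hne.symm

end

/-- An interval graph comes from an interval order. -/
theorem good_of_interval {V : Type*} [Fintype V] {G : SimpleGraph V} (h : IsIntervalGraph G) :
    ∃ P, Good G P := by
  obtain ⟨f, hf, hab⟩ := h
  choose a b hab using hab
  obtain ⟨M, hM⟩ : ∃ M : ℝ, ∀ v, b v < M := by
    obtain ⟨M, hM⟩ := (Set.finite_range b).bddAbove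
    exact ⟨M + 1, fun v => by linarith [hM ⟨v, rfl⟩]⟩
  classical
  let e := Fintype.equivFin V
  let a' : V → ℝ := fun v => if a v ≤ b v then a v else M + (e v : ℕ)
  let b' : V → ℝ := fun v => if a v ≤ b v then b v else M + (e v : ℕ)
  have hle : ∀ v, a' v ≤ b' v := by
    intro v
    simp only [a', b']
    split_ifs with h
    · exact h
    · exact le_rfl
  refine ⟨fun u v => b' u < a' v, ⟨fun v => not_lt.2 (hle v), ?_, ?_⟩⟩
  · intro p q r s h1 h2
    by_contra hc
    push Not at hc
    linarith [hc.1, hc.2]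
  · intro u v
    by_cases hne : u = v
    · subst hne; simp
    rw [hf u v hne, hab, hab, Set.Icc_inter_Icc, Set.nonempty_Icc, sup_le_iff, le_inf_iff,
      le_inf_iff]
    simp only [not_lt, a', b']
    have hMu := hM u
    have hMv := hM v
    have c1 : (0 : ℝ) ≤ ((e u : ℕ) : ℝ) := Nat.cast_nonneg _
    have c2 : (0 : ℝ) ≤ ((e v : ℕ) : ℝ) := Nat.cast_nonneg _
    split_ifs with h2 h1 h1
    · exact ⟨fun h => ⟨hne, h.2.1, h.1.2⟩, fun h => ⟨⟨h1, h.2.2⟩, ⟨h.2.1, h2⟩⟩⟩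
    · constructor
      · intro h; exact absurd h.1.1 h1
      · intro h; linarith [h.2.2]
    · constructor
      · intro h; exact absurd h.2.2 h2
      · intro h; linarith [h.2.1]
    · constructor
      · intro h; exact absurd h.1.1 h1
      · intro h
        exfalso
        have h3 : ((e u : ℕ) : ℝ) = ((e v : ℕ) : ℝ) := by linarith [h.2.1, h.2.2]
        have h4 : (e u : ℕ) = (e v : ℕ) := by exact_mod_cast h3
        exact hne (e.injective (Fin.ext h4))

end MixedUnit


namespace MixedUnit

/-! ## Mixed unit interval graphs have none of the forbidden induced subgraphs -/

theorem UI_ordConnected (c : ℝ) (l r : Prop) : (UI c l r).OrdConnected := by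
  constructor
  rintro a ⟨a1, a2, a3, a4⟩ b ⟨b1, b2, b3, b4⟩ t ⟨h1, h2⟩
  refine ⟨by linarith, by linarith, fun h => a3 (by linarith), fun h => b4 (by linarith)⟩

theorem UI_nonempty (c : ℝ) (l r : Prop) : (UI c l r).Nonempty :=
  ⟨c + 1 / 2, by linarith, by linarith, fun h => by linarith, fun h => by linarith⟩

theorem interval_of_ordConnected {V : Type*} [Fintype V] {G : SimpleGraph V} {f : V → Set ℝ}
    (hf : IsIntervalRep G f) (hc : ∀ v, (f v).OrdConnected) (hn : ∀ v, (f v).Nonempty) :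
    IsIntervalGraph G := by
  classical
  choose d hd using hn
  have hq : ∀ uv : V × V, ∃ t, t ∈ f uv.1 ∧ ((f uv.1 ∩ f uv.2).Nonempty → t ∈ f uv.2) := by
    rintro ⟨u, v⟩
    by_cases h : (f u ∩ f v).Nonempty
    · obtain ⟨t, h1, h2⟩ := h
      exact ⟨t, h1, fun _ => h2⟩
    · exact ⟨d u, hd u, fun h' => absurd h' h⟩
  choose q hq1 hq2 using hq
  let T : Finset ℝ := Finset.univ.image q
  have hT : ∀ v, (T.filter (· ∈ f v)).Nonempty := fun v =>
    ⟨q (v, v), Finset.mem_filter.2 ⟨Finset.mem_image_of_mem _ (Finset.mem_univ _), hq1 (v, v)⟩⟩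
  have hsub : ∀ v, Set.Icc ((T.filter (· ∈ f v)).min' (hT v)) ((T.filter (· ∈ f v)).max' (hT v))
      ⊆ f v := fun v =>
    (hc v).out (Finset.mem_filter.1 (Finset.min'_mem _ (hT v))).2
      (Finset.mem_filter.1 (Finset.max'_mem _ (hT v))).2
  refine ⟨fun v => Set.Icc ((T.filter (· ∈ f v)).min' (hT v)) ((T.filter (· ∈ f v)).max' (hT v)),
    ?_, fun v => ⟨_, _, rfl⟩⟩
  intro u v hne
  rw [hf u v hne]
  constructor
  · intro h
    have m : ∀ w, q (u, v) ∈ f w → q (u, v) ∈ T.filter (· ∈ f w) := fun w hw =>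
      Finset.mem_filter.2 ⟨Finset.mem_image_of_mem _ (Finset.mem_univ _), hw⟩
    have m1 := m u (hq1 (u, v))
    have m2 := m v (hq2 (u, v) h)
    exact ⟨q (u, v), ⟨Finset.min'_le _ _ m1, Finset.le_max' _ _ m1⟩,
      ⟨Finset.min'_le _ _ m2, Finset.le_max' _ _ m2⟩⟩
  · rintro ⟨t, h1, h2⟩
    exact ⟨t, hsub u h1, hsub v h2⟩

/-- the intersection relation of two unit intervals -/
def AR {V : Type*} (x : V → ℝ) (l r : V → Prop) (u v : V) : Prop :=
  (x u < x v + 1 ∧ x v < x u + 1) ∨ (x v = x u + 1 ∧ r u ∧ l v) ∨ (x u = x v + 1 ∧ r v ∧ l u)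

/-- A mixed unit interval representation of a twin-free graph. -/
structure Rep {V : Type*} (G : SimpleGraph V) (x : V → ℝ) (l r : V → Prop) : Prop where
  adj : ∀ u v, u ≠ v → (G.Adj u v ↔ AR x l r u v)
  inj : ∀ u v, x u = x v → (l u ↔ l v) → (r u ↔ r v) → u = v

theorem Rep.swap {V : Type*} {G : SimpleGraph V} {x : V → ℝ} {l r : V → Prop}
    (h : Rep G x l r) : Rep G (fun v => - x v) r l where
  adj := fun u v hne => by
    rw [h.adj u v hne]
    unfold AR
    constructor
    · rintro (⟨h1, h2⟩ | ⟨h1, h2, h3⟩ | ⟨h1, h2, h3⟩)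
      · exact Or.inl ⟨by linarith, by linarith⟩
      · exact Or.inr (Or.inr ⟨by linarith, h3, h2⟩)
      · exact Or.inr (Or.inl ⟨by linarith, h3, h2⟩)
    · rintro (⟨h1, h2⟩ | ⟨h1, h2, h3⟩ | ⟨h1, h2, h3⟩)
      · exact Or.inl ⟨by linarith, by linarith⟩
      · exact Or.inr (Or.inr ⟨by linarith, h3, h2⟩)
      · exact Or.inr (Or.inl ⟨by linarith, h3, h2⟩)
  inj := fun u v h1 h2 h3 => h.inj u v (by linarith) h3 h2

theorem rep_of_mixed {V : Type*} {G : SimpleGraph V} (htf : TwinFree G) {x : V → ℝ}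
    {l r : V → Prop} (h : IsIntervalRep G (fun v => UI (x v) (l v) (r v))) : Rep G x l r := by
  have hadj : ∀ u v, u ≠ v → (G.Adj u v ↔ AR x l r u v) := by
    intro u v hne
    rw [h u v hne, UI_inter]
    rfl
  refine ⟨hadj, fun u v h1 h2 h3 => htf u v ?_⟩
  have key : ∀ a z, z ∈ insert a (G.neighborSet a) ↔ AR x l r a z := by
    intro a z
    rw [Set.mem_insert_iff, SimpleGraph.mem_neighborSet]
    by_cases e : z = a
    · subst e
      exact ⟨fun _ => Or.inl ⟨by linarith, by linarith⟩, fun _ => Or.inl rfl⟩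
    · rw [hadj a z (Ne.symm e)]
      exact ⟨fun h => h.resolve_left e, Or.inr⟩
  ext z
  rw [key, key]
  unfold AR
  rw [h1, h2, h3]

section
variable {V : Type*} {G : SimpleGraph V} {x : V → ℝ} {l r : V → Prop}

/-- positions of a claw -/
def C3P (x : V → ℝ) (l r : V → Prop) (c a b y : V) : Prop :=
  x c = x a + 1 ∧ x b = x c ∧ x y = x c + 1 ∧ r a ∧ l y ∧ ¬ l b ∧ ¬ r b ∧ l c ∧ r c

theorem claw_aux (h : Rep G x l r) {c a b y : V} (ha : G.Adj c a) (hb : G.Adj c b)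
    (hy : G.Adj c y) (hab : ¬ G.Adj a b) (hay : ¬ G.Adj a y) (hby : ¬ G.Adj b y) (nab : a ≠ b)
    (nay : a ≠ y) (nby : b ≠ y) (o1 : x a ≤ x b) (o2 : x b ≤ x y) : C3P x l r c a b y := by
  rw [h.adj _ _ ha.ne] at ha
  rw [h.adj _ _ hb.ne] at hb
  rw [h.adj _ _ hy.ne] at hy
  rw [h.adj _ _ nab] at hab
  rw [h.adj _ _ nay] at hay
  rw [h.adj _ _ nby] at hby
  unfold AR at *
  push Not at hab hay hby
  have e1 : x a + 1 ≤ x b := by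
    by_contra hc
    linarith [hab.1 (by linarith)]
  have e2 : x b + 1 ≤ x y := by
    by_contra hc
    linarith [hby.1 (by linarith)]
  have e3 : x c ≤ x a + 1 := by
    rcases ha with ha | ha | ha <;> linarith [ha.1, ha.2]
  have e4 : x y ≤ x c + 1 := by
    rcases hy with ha | ha | ha <;> linarith [ha.1, ha.2]
  have f1 : x c = x a + 1 := by linarith
  have f2 : x b = x c := by linarith
  have f3 : x y = x c + 1 := by linarith
  have g1 : r a ∧ l c := by
    rcases ha with ha | ha | ha
    · linarith [ha.1, ha.2]
    · linarith [ha.1]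
    · exact ha.2
  have g2 : r c ∧ l y := by
    rcases hy with ha | ha | ha
    · linarith [ha.1, ha.2]
    · exact ha.2
    · linarith [ha.1]
  have g3 := hab.2.1 (by linarith) g1.1
  have g4 : ¬ r b := fun h => hby.2.1 (by linarith) h g2.2
  exact ⟨f1, f2, f3, g1.1, g2.2, g3, g4, g1.2, g2.1⟩

theorem claw (h : Rep G x l r) {c a b y : V} (ha : G.Adj c a) (hb : G.Adj c b)
    (hy : G.Adj c y) (hab : ¬ G.Adj a b) (hay : ¬ G.Adj a y) (hby : ¬ G.Adj b y) (nab : a ≠ b)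
    (nay : a ≠ y) (nby : b ≠ y) : C3P x l r c a b y ∨ C3P x l r c a y b ∨ C3P x l r c b a y ∨
      C3P x l r c b y a ∨ C3P x l r c y a b ∨ C3P x l r c y b a := by
  have hba : ¬ G.Adj b a := fun h => hab h.symm
  have hya : ¬ G.Adj y a := fun h => hay h.symm
  have hyb : ¬ G.Adj y b := fun h => hby h.symm
  rcases le_total (x a) (x b) with o1 | o1
  · rcases le_total (x b) (x y) with o2 | o2
    · exact Or.inl (claw_aux h ha hb hy hab hay hby nab nay nby o1 o2)
    · rcases le_total (x a) (x y) with o3 | o3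
      · exact Or.inr (Or.inl (claw_aux h ha hy hb hay hab hyb nay nab nby.symm o3 o2))
      · exact Or.inr (Or.inr (Or.inr (Or.inr (Or.inl
          (claw_aux h hy ha hb hya hyb hab nay.symm nby.symm nab o3 o1)))))
  · rcases le_total (x a) (x y) with o2 | o2
    · exact Or.inr (Or.inr (Or.inl
        (claw_aux h hb ha hy hba hby hay nab.symm nby nay o1 o2)))
    · rcases le_total (x b) (x y) with o3 | o3
      · exact Or.inr (Or.inr (Or.inr (Or.inl
          (claw_aux h hb hy ha hby hba hya nby nab.symm nay.symm o3 o2))))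
      · exact Or.inr (Or.inr (Or.inr (Or.inr (Or.inr
          (claw_aux h hy hb ha hyb hya hba nby.symm nay.symm nab.symm o3 o1)))))

/-- `y` completes the pair `a, b` to a claw with center `c`. -/
structure Y0 (G : SimpleGraph V) (c a b y : V) : Prop where
  ca : G.Adj c a
  cb : G.Adj c b
  cy : G.Adj c y
  ab : ¬ G.Adj a b
  ay : ¬ G.Adj a y
  yb : ¬ G.Adj b y
  nab : a ≠ b
  nay : a ≠ y
  nby : b ≠ y

/-- `v, w` are the special vertices of some induced `Q_k` (up to the adjacency of `v, w`), and
`c` is their common neighbor. -/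
inductive QC (G : SimpleGraph V) : V → V → V → Prop
  | base {c a b v w : V} : Y0 G c a b v → Y0 G c a b w → v ≠ w → QC G c v w
  | step {c v w y1 y2 : V} : QC G c v w → G.Adj v y1 → G.Adj v y2 → ¬ G.Adj w y1 → ¬ G.Adj w y2 →
      w ≠ y1 → w ≠ y2 → y1 ≠ y2 → QC G v y1 y2

/-- conclusion on positions -/
def QP (x : V → ℝ) (l : V → Prop) (c v w : V) : Prop :=
  x v = x c + 1 ∧ x w = x c + 1 ∧ l v ∧ l w

theorem sep (h : Rep G x l r) {v w y : V} (hx : x v = x w) (hw : l w)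
    (h1 : G.Adj v y) (h2 : ¬ G.Adj w y) (h3 : w ≠ y) :
    x y = x v + 1 ∧ l y ∧ r v ∧ ¬ r w := by
  rw [h.adj _ _ h1.ne] at h1
  rw [h.adj _ _ h3] at h2
  unfold AR at *
  push Not at h2
  rcases h1 with h1 | h1 | h1
  · have := h2.1 (by linarith [h1.1])
    linarith [h1.2]
  · exact ⟨h1.1, h1.2.2, h1.2.1, fun h4 => h2.2.1 (by linarith [h1.1]) h4 h1.2.2⟩
  · exact absurd hw (h2.2.2 (by linarith [h1.1]) h1.2.1)

theorem Y0.claw (h : Rep G x l r) {c a b y : V} (hy : Y0 G c a b y) :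
    C3P x l r c a b y ∨ C3P x l r c a y b ∨ C3P x l r c b a y ∨
      C3P x l r c b y a ∨ C3P x l r c y a b ∨ C3P x l r c y b a :=
  MixedUnit.claw h hy.ca hy.cb hy.cy hy.ab hy.ay hy.yb hy.nab hy.nay hy.nby

theorem QC.pos (h : Rep G x l r) {c v w : V} (hq : QC G c v w) :
    QP x l c v w ∨ QP (fun v => - x v) r c v w := by
  induction hq with
  | @base c a b v w hv hw hne =>
    have i := h.inj v w
    unfold QP
    rcases hv.claw h with h1 | h1 | h1 | h1 | h1 | h1 <;>
    rcases hw.claw h with h2 | h2 | h2 | h2 | h2 | h2 <;>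
    obtain ⟨a1, a2, a3, a4, a5, a6, a7, a8, a9⟩ := h1 <;>
    obtain ⟨b1, b2, b3, b4, b5, b6, b7, b8, b9⟩ := h2 <;>
    first
    | (exfalso; linarith)
    | exact absurd (i (by linarith) (by tauto) (by tauto)) hne
    | exact Or.inl ⟨by linarith, by linarith, by assumption, by assumption⟩
    | exact Or.inr ⟨by linarith, by linarith, by assumption, by assumption⟩
  | @step c v w y1 y2 hq a1 a2 a3 a4 a5 a6 a7 ih =>
    rcases ih with ⟨h1, h2, h3, h4⟩ | ⟨h1, h2, h3, h4⟩
    · have s1 := sep h (by linarith) h4 a1 a3 a5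
      have s2 := sep h (by linarith) h4 a2 a4 a6
      exact Or.inl ⟨s1.1, s2.1, s1.2.1, s2.2.1⟩
    · have s1 := sep h.swap (by linarith) h4 a1 a3 a5
      have s2 := sep h.swap (by linarith) h4 a2 a4 a6
      exact Or.inr ⟨s1.1, s2.1, s1.2.1, s2.2.1⟩

theorem same_adj (h : Rep G x l r) {u v : V} (hne : u ≠ v) (hx : x u = x v) : G.Adj u v := by
  rw [h.adj _ _ hne]
  exact Or.inl ⟨by linarith, by linarith⟩

theorem no_R (h : Rep G x l r) {c v w : V} (hq : QC G c v w) (hne : v ≠ w)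
    (hadj : ¬ G.Adj v w) : False := by
  apply hadj
  apply same_adj h hne
  rcases hq.pos h with ⟨h1, h2, -⟩ | ⟨h1, h2, -⟩ <;> linarith

theorem no_S' (h : Rep G x l r) {c v w z : V} (h1 : QC G c v w) (h2 : QC G c v z)
    (h3 : QC G c w z) (n1 : v ≠ w) (n2 : v ≠ z) (n3 : w ≠ z) : False := by
  have i1 := h.inj v w
  have i2 := h.inj v z
  have i3 := h.inj w z
  rcases h1.pos h with ⟨a1, a2, a3, a4⟩ | ⟨a1, a2, a3, a4⟩ <;>
  rcases h2.pos h with ⟨b1, b2, b3, b4⟩ | ⟨b1, b2, b3, b4⟩ <;>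
  rcases h3.pos h with ⟨c1, c2, c3, c4⟩ | ⟨c1, c2, c3, c4⟩ <;>
  first
  | (exfalso; linarith)
  | (replace i1 := i1 (by linarith)
     replace i2 := i2 (by linarith)
     replace i3 := i3 (by linarith)
     tauto)

theorem no_S_aux (h : Rep G x l r) {c v w z : V} (h1 : QP x l c v w) (hz : G.Adj w z)
    (hz2 : ¬ G.Adj v z) (hz3 : G.Adj c z) (n : v ≠ z) : False := by
  obtain ⟨a1, a2, a3, a4⟩ := h1
  have s := sep h (by linarith) a3 hz hz2 n
  rw [h.adj _ _ hz3.ne] at hz3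
  rcases hz3 with h5 | h5 | h5 <;> linarith [h5.1, h5.2, s.1]

theorem no_S (h : Rep G x l r) {c v w z : V} (h1 : QC G c v w) (hz : G.Adj w z)
    (hz2 : ¬ G.Adj v z) (hz3 : G.Adj c z) (n : v ≠ z) : False := by
  rcases h1.pos h with h1 | h1
  · exact no_S_aux h h1 hz hz2 hz3 n
  · exact no_S_aux h.swap h1 hz hz2 hz3 n

theorem no_T_aux (h : Rep G x l r) {c v w q u : V} (h1 : QP x l c v w) (hvu : G.Adj v u)
    (hwu : ¬ G.Adj w u) (hwq : G.Adj w q) (n : w ≠ u) (hx : x q = x u) : False := by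
  obtain ⟨a1, a2, a3, a4⟩ := h1
  have s := sep h (by linarith) a4 hvu hwu n
  rw [h.adj _ _ hwq.ne] at hwq
  rcases hwq with h5 | h5 | h5
  · linarith [h5.1, h5.2, s.1]
  · exact s.2.2.2 h5.2.1
  · linarith [h5.1, s.1]

theorem no_T (h : Rep G x l r) {c d v w q u : V} (h1 : QC G c v w) (h2 : QC G d q u)
    (hvu : G.Adj v u) (hwu : ¬ G.Adj w u) (hwq : G.Adj w q) (n : w ≠ u) : False := by
  have hx : x q = x u := by
    rcases h2.pos h with ⟨h1, h2, -⟩ | ⟨h1, h2, -⟩ <;> linarith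
  rcases h1.pos h with h1 | h1
  · exact no_T_aux h h1 hvu hwu hwq n hx
  · exact no_T_aux h.swap h1 hvu hwu hwq n (by linarith)

theorem no_T0_aux (h : Rep G x l r) {c v w q u a : V} (h1 : QP x l c v w) (hy : Y0 G q a u w)
    (hvu : G.Adj v u) : False := by
  obtain ⟨a1, a2, a3, a4⟩ := h1
  have s := sep h (by linarith) a4 hvu (fun h => hy.yb h.symm) hy.nby.symm
  obtain ⟨s1, s2, s3, s4⟩ := s
  rcases hy.claw h with h1 | h1 | h1 | h1 | h1 | h1 <;>
  obtain ⟨b1, b2, b3, b4, b5, b6, b7, b8, b9⟩ := h1 <;>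
  first
  | (exfalso; linarith)
  | (exfalso; tauto)

theorem no_T0 (h : Rep G x l r) {c v w q u a : V} (h1 : QC G c v w) (hy : Y0 G q a u w)
    (hvu : G.Adj v u) : False := by
  rcases h1.pos h with h1 | h1
  · exact no_T0_aux h h1 hy hvu
  · exact no_T0_aux h.swap h1 hy hvu

theorem no_T00 (h : Rep G x l r) {v w q u a a' : V} (h1 : Y0 G v a w u) (h2 : Y0 G q a' u w)
    (n : a ≠ a') (hadj : ¬ G.Adj a a') : False := by
  have hx : x a ≠ x a' := fun hx => hadj (same_adj h n hx)
  rcases h1.claw h with h1 | h1 | h1 | h1 | h1 | h1 <;>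
  rcases h2.claw h with h2 | h2 | h2 | h2 | h2 | h2 <;>
  obtain ⟨a1, a2, a3, a4, a5, a6, a7, a8, a9⟩ := h1 <;>
  obtain ⟨b1, b2, b3, b4, b5, b6, b7, b8, b9⟩ := h2 <;>
  first
  | (exfalso; linarith)
  | (exfalso; tauto)
  | exact hx (by linarith)

/-- An embedded `Q_k`. -/
structure QE (G : SimpleGraph V) (k : ℕ) (f : QVert k → V) : Prop where
  inj : Function.Injective f
  adj : ∀ a b, G.Adj (f a) (f b) ↔ (Qgraph k).Adj a b

theorem QE.base {k : ℕ} {f : QVert k → V} (h : QE G k f) :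
    G.Adj (f (Sum.inl 0)) (f (Sum.inr (Sum.inr 0))) ∧
    G.Adj (f (Sum.inl 0)) (f (Sum.inr (Sum.inr 1))) ∧
    ¬ G.Adj (f (Sum.inr (Sum.inr 0))) (f (Sum.inr (Sum.inr 1))) ∧
    f (Sum.inr (Sum.inr 0)) ≠ f (Sum.inr (Sum.inr 1)) := by
  simp [h.adj, h.inj.eq_iff, Qgraph, Qadj]

theorem QE.qc {k : ℕ} {f : QVert k → V} (h : QE G k f) (i : ℕ) (hi : i < k) :
    QC G (f (Sum.inl ⟨i, by omega⟩)) (f (Sum.inl ⟨i + 1, by omega⟩))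
      (f (Sum.inr (Sum.inl ⟨i, hi⟩))) := by
  induction i with
  | zero =>
    obtain ⟨b1, b2, b3, b4⟩ := h.base
    refine QC.base (a := f (Sum.inr (Sum.inr 0))) (b := f (Sum.inr (Sum.inr 1)))
      ⟨b1, b2, ?_, b3, ?_, ?_, b4, ?_, ?_⟩ ⟨b1, b2, ?_, b3, ?_, ?_, b4, ?_, ?_⟩ ?_ <;>
    simp [h.adj, h.inj.eq_iff, Qgraph, Qadj]
  | succ i ih =>
    refine QC.step (ih (by omega)) ?_ ?_ ?_ ?_ ?_ ?_ ?_ <;>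
    simp [h.adj, h.inj.eq_iff, Qgraph, Qadj]
    omega

theorem QE.qc' {k : ℕ} {f : QVert (k + 1) → V} (h : QE G (k + 1) f) :
    QC G (f (Sum.inl ⟨k, by omega⟩)) (f (Qspecial1 (k + 1))) (f (Qspecial2 (k + 1))) := by
  have := h.qc k (by omega)
  have e : Qspecial2 (k + 1) = Sum.inr (Sum.inl ⟨k, by omega⟩) := by
    simp [Qspecial2]
  rw [e]
  exact this

end

end MixedUnit


namespace MixedUnit

section
variable {V : Type*} {G : SimpleGraph V} {x : V → ℝ} {l r : V → Prop}

theorem rep_K (h : Rep G x l r) : ¬ HasInducedSubgraph G K23star := by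
  rintro ⟨f, hf⟩
  have y1 : Y0 G (f 0) (f 2) (f 3) (f 4) := by
    constructor <;> simp [← hf, K23star]
  have y2 : Y0 G (f 1) (f 2) (f 3) (f 4) := by
    constructor <;> simp [← hf, K23star]
  have n : f 0 ≠ f 1 := by simp
  apply n
  have s1 : 3 * x (f 0) = x (f 2) + x (f 3) + x (f 4) ∧ l (f 0) ∧ r (f 0) := by
    rcases y1.claw h with h1 | h1 | h1 | h1 | h1 | h1 <;>
    · obtain ⟨a1, a2, a3, a4, a5, a6, a7, a8, a9⟩ := h1
      exact ⟨by linarith, a8, a9⟩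
  have s2 : 3 * x (f 1) = x (f 2) + x (f 3) + x (f 4) ∧ l (f 1) ∧ r (f 1) := by
    rcases y2.claw h with h1 | h1 | h1 | h1 | h1 | h1 <;>
    · obtain ⟨a1, a2, a3, a4, a5, a6, a7, a8, a9⟩ := h1
      exact ⟨by linarith, a8, a9⟩
  exact h.inj _ _ (by linarith [s1.1, s2.1]) (by tauto) (by tauto)

/-- the copy of `Q_k` in `R_k` -/
def gR (k : ℕ) : QVert k → Fin (k + 3) ⊕ (Fin k ⊕ Fin 2)
  | Sum.inl m => Sum.inl ⟨m + 1, by omega⟩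
  | Sum.inr (Sum.inl i) => Sum.inr (Sum.inl i)
  | Sum.inr (Sum.inr j) => if j = 0 then Sum.inl 0 else Sum.inr (Sum.inr 0)

theorem rep_R (h : Rep G x l r) (k : ℕ) : ¬ HasInducedSubgraph G (Rgraph k) := by
  rintro ⟨f, hf⟩
  have hq : QE G k (fun a => f (gR k a)) := by
    constructor
    · intro a b hab
      have hab := f.injective hab
      rcases a with ⟨m, hm⟩ | ⟨i, hi⟩ | j <;> rcases b with ⟨m', hm'⟩ | ⟨i', hi'⟩ | j' <;>
        (try fin_cases j) <;> (try fin_cases j') <;> simp_all [gR, Fin.ext_iff]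
    · intro a b
      rw [← hf]
      rcases a with ⟨m, hm⟩ | ⟨i, hi⟩ | j <;> rcases b with ⟨m', hm'⟩ | ⟨i', hi'⟩ | j' <;>
        (try fin_cases j) <;> (try fin_cases j') <;>
        simp [gR, Rgraph, Qgraph, Radj, Qadj, Fin.ext_iff] <;> omega
  have n : f (Sum.inl ⟨k + 2, by omega⟩) ≠ f (Sum.inr (Sum.inr 1)) := by simp
  have na : ¬ G.Adj (f (Sum.inl ⟨k + 2, by omega⟩)) (f (Sum.inr (Sum.inr 1))) := by
    simp [← hf, Rgraph, Radj]
  rcases k with _ | k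
  · obtain ⟨b1, b2, b3, b4⟩ := hq.base
    refine no_R h (QC.base ⟨b1, b2, ?_, b3, ?_, ?_, b4, ?_, ?_⟩
      ⟨b1, b2, ?_, b3, ?_, ?_, b4, ?_, ?_⟩ n) n na <;>
    simp [← hf, Rgraph, Radj, gR, Fin.ext_iff]
  · refine no_R h (QC.step (hq.qc k (by omega)) ?_ ?_ ?_ ?_ ?_ ?_ n) n na <;>
    simp [← hf, Rgraph, Radj, gR, Fin.ext_iff]
    try omega

theorem rep_S (h : Rep G x l r) (k : ℕ) (hk : 1 ≤ k) : ¬ HasInducedSubgraph G (Sgraph k) := by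
  rintro ⟨f, hf⟩
  have hq : QE G k (fun a => f (Sum.inl a)) := by
    constructor
    · intro a b hab
      exact Sum.inl_injective (f.injective hab)
    · intro a b
      rw [← hf]
      simp [Sgraph, Qgraph, Sadj]
  obtain ⟨k, rfl⟩ : ∃ k', k = k' + 1 := ⟨k - 1, by omega⟩
  refine no_S h hq.qc' (z := f (Sum.inr ())) ?_ ?_ ?_ ?_
  · simp [← hf, Sgraph, Sadj]
  · have : Qspecial1 (k + 1) ≠ Qspecial2 (k + 1) := by simp [Qspecial1, Qspecial2]
    have h3 : Qspecial1 (k + 1) ≠ Sextra (k + 1) := by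
      unfold Sextra; split <;> simp [Qspecial1]
    have h4 : Qspecial1 (k + 1) ≠ Sum.inl ⟨k, by omega⟩ := by
      simp [Qspecial1, Fin.ext_iff]
    simp [← hf, Sgraph, Sadj, this, h3, h4]
  · simp [← hf, Sgraph, Sadj]
  · simp

theorem rep_S' (h : Rep G x l r) (k : ℕ) (hk : 1 ≤ k) : ¬ HasInducedSubgraph G (S'graph k) := by
  rintro ⟨f, hf⟩
  have hq : QE G k (fun a => f (Sum.inl a)) := by
    constructor
    · intro a b hab
      exact Sum.inl_injective (f.injective hab)
    · intro a b
      rw [← hf]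
      simp [S'graph, Qgraph, S'adj]
  obtain ⟨k, rfl⟩ : ∃ k', k = k' + 1 := ⟨k - 1, by omega⟩
  have h0 := hq.qc'
  have n1 : f (Sum.inl (Qspecial1 (k + 1))) ≠ f (Sum.inl (Qspecial2 (k + 1))) := by
    simp [Qspecial1, Qspecial2]
  have e1 : Qspecial1 (k + 1) = Sum.inl ⟨k + 1, by omega⟩ := rfl
  have e2 : Qspecial2 (k + 1) = Sum.inr (Sum.inl ⟨k, by omega⟩) := by simp [Qspecial2]
  suffices hs : ∀ s, (s = Qspecial1 (k + 1) ∨ s = Qspecial2 (k + 1)) →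
      QC G (f (Sum.inl (Sum.inl ⟨k, by omega⟩))) (f (Sum.inl s)) (f (Sum.inr ())) from
    no_S' h h0 (hs _ (Or.inl rfl)) (hs _ (Or.inr rfl)) n1 (by simp) (by simp)
  intro s hs
  rcases k with _ | k
  · obtain ⟨b1, b2, b3, b4⟩ := hq.base
    refine QC.base ⟨b1, b2, ?_, b3, ?_, ?_, b4, ?_, ?_⟩
      ⟨b1, b2, ?_, b3, ?_, ?_, b4, ?_, ?_⟩ (by simp) <;>
    rcases hs with rfl | rfl <;>
    simp [← hf, S'graph, S'adj, Qadj, e1, e2]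
  · refine QC.step (hq.qc k (by omega)) ?_ ?_ ?_ ?_ ?_ ?_ (by simp) <;>
    rcases hs with rfl | rfl <;>
    simp [← hf, S'graph, S'adj, Qadj, e1, e2]
    try omega

theorem rep_T (h : Rep G x l r) (i j : ℕ) (hij : j ≤ i) :
    ¬ HasInducedSubgraph G (Tgraph i j) := by
  rintro ⟨f, hf⟩
  have hq : QE G i (fun a => f (Sum.inl a)) := by
    constructor
    · intro a b hab
      exact Sum.inl_injective (f.injective hab)
    · intro a b
      rw [← hf]
      simp [Tgraph, Qgraph, Tadj]
  have hq' : QE G j (fun a => f (Sum.inr a)) := by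
    constructor
    · intro a b hab
      exact Sum.inr_injective (f.injective hab)
    · intro a b
      rw [← hf]
      simp [Tgraph, Qgraph, Tadj]
  have s : ∀ k, Qspecial2 k ≠ Qspecial1 k := by
    intro k
    unfold Qspecial2; split <;> simp [Qspecial1]
  have vu : G.Adj (f (Sum.inl (Qspecial1 i))) (f (Sum.inr (Qspecial2 j))) := by
    simp [← hf, Tgraph, Tadj]
  have wq : G.Adj (f (Sum.inl (Qspecial2 i))) (f (Sum.inr (Qspecial1 j))) := by
    simp [← hf, Tgraph, Tadj]
  have wu : ¬ G.Adj (f (Sum.inl (Qspecial2 i))) (f (Sum.inr (Qspecial2 j))) := by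
    simp [← hf, Tgraph, Tadj, s]
  have nwu : f (Sum.inl (Qspecial2 i)) ≠ f (Sum.inr (Qspecial2 j)) := by simp
  rcases j with _ | j
  · obtain ⟨b1, b2, b3, b4⟩ := hq'.base
    have hy : Y0 G (f (Sum.inr (Sum.inl 0))) (f (Sum.inr (Sum.inr (Sum.inr 0))))
        (f (Sum.inr (Sum.inr (Sum.inr 1)))) (f (Sum.inl (Qspecial2 i))) := by
      refine ⟨b1, b2, wq.symm, b3, ?_, fun h => wu h.symm, b4, by simp, by simp⟩
      simp [← hf, Tgraph, Tadj, Qspecial1, Qspecial2]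
    rcases i with _ | i
    · obtain ⟨c1, c2, c3, c4⟩ := hq.base
      have hy' : Y0 G (f (Sum.inl (Sum.inl 0))) (f (Sum.inl (Sum.inr (Sum.inr 0))))
          (f (Sum.inl (Sum.inr (Sum.inr 1)))) (f (Sum.inr (Qspecial2 0))) := by
        refine ⟨c1, c2, vu, c3, ?_, wu, c4, by simp, by simp⟩
        simp [← hf, Tgraph, Tadj, Qspecial1, Qspecial2]
      refine no_T00 h hy' hy (by simp) ?_
      simp [← hf, Tgraph, Tadj, Qspecial1, Qspecial2]
    · exact no_T0 h hq.qc' hy vu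
  · obtain ⟨i, rfl⟩ : ∃ k', i = k' + 1 := ⟨i - 1, by omega⟩
    exact no_T h hq.qc' hq'.qc' vu wu wq nwu

end

end MixedUnit


/-- Theorem 5 (main theorem): a twin-free graph is a mixed unit interval graph if and only if
it is an interval graph with no induced K_{2,3}^*, R_i (i ≥ 0), S_i (i ≥ 1),
S'_i (i ≥ 1) or T_{i,j} (i ≥ j ≥ 0). -/
theorem mixed_unit_characterization_twin_free {V : Type*} [Fintype V] (G : SimpleGraph V)
    (htf : TwinFree G) :
    MixedUnitIntervalGraph G ↔
      (IsIntervalGraph G ∧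
       ¬ HasInducedSubgraph G K23star ∧
       (∀ i : ℕ, ¬ HasInducedSubgraph G (Rgraph i)) ∧
       (∀ i : ℕ, 1 ≤ i → ¬ HasInducedSubgraph G (Sgraph i)) ∧
       (∀ i : ℕ, 1 ≤ i → ¬ HasInducedSubgraph G (S'graph i)) ∧
       (∀ i j : ℕ, j ≤ i → ¬ HasInducedSubgraph G (Tgraph i j))) := by

  constructor
  · rintro ⟨f, hf, hu⟩
    have hu' := fun v => MixedUnit.isUnit_UI (hu v)
    choose x l r hx using hu'
    obtain rfl : f = fun v => MixedUnit.UI (x v) (l v) (r v) := funext hx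
    have h := MixedUnit.rep_of_mixed htf hf
    exact ⟨MixedUnit.interval_of_ordConnected hf (fun v => MixedUnit.UI_ordConnected _ _ _)
      (fun v => MixedUnit.UI_nonempty _ _ _), MixedUnit.rep_K h, MixedUnit.rep_R h,
      MixedUnit.rep_S h, MixedUnit.rep_S' h, MixedUnit.rep_T h⟩
  · rintro ⟨hi, h1, h2, h3, h4, h5⟩
    obtain ⟨P, hP⟩ := MixedUnit.good_of_interval hi
    exact MixedUnit.mixed_of_good hP ⟨htf, h1, h2, h3, h4, h5⟩
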